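/- arXiv:1801.08109 — 3 statements merged into one kernel-verified Lean document; each statement's English description precedes it below -/
import Mathlib

section
/- Let μ ∈ C_c^∞(ℂ) with ‖μ‖_∞ = k < 1. Then there exists an orientation-preserving homeomorphism Φ : ℂ → ℂ of class C¹(ℂ) that solves the Beltrami equation ∂_z̄ Φ = μ ∂_z Φ on all of ℂ. -/
open MeasureTheory Complex ENNReal NNReal Metric Set Filter

/-- The Wirtinger derivative `∂_z f = (∂_x f - i ∂_y f)/2` of `f : ℂ → ℂ`,
computed from the real Fréchet derivative. -/
noncomputable def dZ (f : ℂ → ℂ) (z : ℂ) : ℂ :=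
  (fderiv ℝ f z 1 - Complex.I * fderiv ℝ f z Complex.I) / 2

/-- The Wirtinger derivative `∂_z̄ f = (∂_x f + i ∂_y f)/2` of `f : ℂ → ℂ`. -/
noncomputable def dZbar (f : ℂ → ℂ) (z : ℂ) : ℂ :=
  (fderiv ℝ f z 1 + Complex.I * fderiv ℝ f z Complex.I) / 2

/-- `g` is the weak (distributional) Wirtinger derivative `∂_z u`, defined by testing
against smooth compactly supported functions: `∫ u ∂_z φ = -∫ g φ`. -/
def HasWeakDz (u g : ℂ → ℂ) : Prop :=
  ∀ φ : ℂ → ℂ, ContDiff ℝ (⊤ : ℕ∞) φ → HasCompactSupport φ →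
    (∫ z : ℂ, u z * dZ φ z) = - ∫ z : ℂ, g z * φ z

/-- `g` is the weak (distributional) Wirtinger derivative `∂_z̄ u`. -/
def HasWeakDzbar (u g : ℂ → ℂ) : Prop :=
  ∀ φ : ℂ → ℂ, ContDiff ℝ (⊤ : ℕ∞) φ → HasCompactSupport φ →
    (∫ z : ℂ, u z * dZbar φ z) = - ∫ z : ℂ, g z * φ z

open scoped Convolution Topology ContDiff

/-- The Cauchy kernel `1 / (π z)`, a fundamental solution of `∂_z̄`. -/
noncomputable def cauchyKernel (z : ℂ) : ℂ := ((Real.pi : ℂ) * z)⁻¹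

/-- The Cauchy transform `g ↦ 1/(π z) ⋆ g`. -/
noncomputable def cauchyTransform (g : ℂ → ℂ) : ℂ → ℂ :=
  cauchyKernel ⋆[ContinuousLinearMap.mul ℝ ℂ, volume] g

theorem norm_cauchyKernel (z : ℂ) : ‖cauchyKernel z‖ = (Real.pi * ‖z‖)⁻¹ := by
  simp [cauchyKernel, abs_of_pos Real.pi_pos]

theorem measurable_cauchyKernel : Measurable cauchyKernel := by
  unfold cauchyKernel; fun_prop

theorem integrableOn_cauchyKernel_ball (r : ℝ) : IntegrableOn cauchyKernel (ball 0 r) := by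
  have h : IntegrableOn (fun z : ℂ => (Real.pi * ‖z‖)⁻¹) (ball 0 r) := by
    rw [integrableOn_fun_norm_addHaar volume (f := fun y : ℝ => (Real.pi * y)⁻¹)]
    have : IntegrableOn (fun _ : ℝ => (Real.pi)⁻¹) (Ioo 0 r) := by
      simp
    refine this.congr_fun (fun y hy => ?_) measurableSet_Ioo
    have hy0 : y ≠ 0 := hy.1.ne'
    have := Real.pi_pos.ne'
    simp [Complex.finrank_real_complex]
    field_simp
  refine h.mono' measurable_cauchyKernel.aestronglyMeasurable ?_
  exact Eventually.of_forall fun z => (norm_cauchyKernel z).le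

theorem locallyIntegrable_cauchyKernel : LocallyIntegrable cauchyKernel := by
  rw [locallyIntegrable_iff]
  intro k hk
  obtain ⟨r, hr⟩ := hk.isBounded.subset_ball 0
  exact (integrableOn_cauchyKernel_ball r).mono_set hr

theorem cauchyTransform_apply (g : ℂ → ℂ) (z : ℂ) :
    cauchyTransform g z = ∫ w, cauchyKernel w * g (z - w) := rfl

theorem contDiff_cauchyTransform {n : ℕ∞} {g : ℂ → ℂ} (hg : ContDiff ℝ n g)
    (hc : HasCompactSupport g) : ContDiff ℝ n (cauchyTransform g) :=
  hc.contDiff_convolution_right _ locallyIntegrable_cauchyKernel hg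

theorem continuous_cauchyTransform {g : ℂ → ℂ} (hg : Continuous g)
    (hc : HasCompactSupport g) : Continuous (cauchyTransform g) :=
  hc.continuous_convolution_right _ locallyIntegrable_cauchyKernel hg

theorem fderiv_cauchyTransform {g : ℂ → ℂ} (hg : ContDiff ℝ 1 g)
    (hc : HasCompactSupport g) (z v : ℂ) :
    fderiv ℝ (cauchyTransform g) z v = cauchyTransform (fun w => fderiv ℝ g w v) z := by
  have := hc.hasFDerivAt_convolution_right (ContinuousLinearMap.mul ℝ ℂ)
    locallyIntegrable_cauchyKernel hg z
  unfold cauchyTransform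
  rw [this.fderiv, convolution_precompR_apply _ locallyIntegrable_cauchyKernel (hc.fderiv ℝ)
    (hg.continuous_fderiv one_ne_zero)]

theorem integrable_cauchyTransform_integrand {g : ℂ → ℂ} (hg : Continuous g)
    (hc : HasCompactSupport g) (z : ℂ) :
    Integrable fun w => cauchyKernel w * g (z - w) :=
  hc.convolutionExists_right (ContinuousLinearMap.mul ℝ ℂ) locallyIntegrable_cauchyKernel hg z

theorem cauchyTransform_add {f g : ℂ → ℂ} (hf : Continuous f) (hfc : HasCompactSupport f)
    (hg : Continuous g) (hgc : HasCompactSupport g) (z : ℂ) :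
    cauchyTransform (fun w => f w + g w) z = cauchyTransform f z + cauchyTransform g z := by
  simp only [cauchyTransform_apply, mul_add]
  exact integral_add (integrable_cauchyTransform_integrand hf hfc z)
    (integrable_cauchyTransform_integrand hg hgc z)

theorem cauchyTransform_const_mul (c : ℂ) (g : ℂ → ℂ) (z : ℂ) :
    cauchyTransform (fun w => c * g w) z = c * cauchyTransform g z := by
  simp only [cauchyTransform_apply, mul_left_comm _ c, integral_const_mul]

theorem dZ_eq (f : ℂ → ℂ) :
    dZ f = fun z => (1 / 2) * fderiv ℝ f z 1 + (-I / 2) * fderiv ℝ f z I := by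
  ext z; simp only [dZ]; ring

theorem dZbar_eq (f : ℂ → ℂ) :
    dZbar f = fun z => (1 / 2) * fderiv ℝ f z 1 + (I / 2) * fderiv ℝ f z I := by
  ext z; simp only [dZbar]; ring

theorem continuous_fderiv_apply_const {f : ℂ → ℂ} (hf : ContDiff ℝ 1 f) (v : ℂ) :
    Continuous fun z => fderiv ℝ f z v :=
  (hf.continuous_fderiv one_ne_zero).clm_apply continuous_const

theorem dZ_cauchyTransform {g : ℂ → ℂ} (hg : ContDiff ℝ 1 g) (hc : HasCompactSupport g) :
    dZ (cauchyTransform g) = cauchyTransform (dZ g) := by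
  ext z
  have h v := continuous_fderiv_apply_const hg v
  have h' v := hc.fderiv_apply ℝ v
  rw [dZ_eq g, cauchyTransform_add ((h 1).const_mul _) (h' 1).mul_left ((h I).const_mul _)
    (h' I).mul_left, cauchyTransform_const_mul, cauchyTransform_const_mul, dZ_eq]
  simp only [fderiv_cauchyTransform hg hc]

theorem dZbar_cauchyTransform {g : ℂ → ℂ} (hg : ContDiff ℝ 1 g) (hc : HasCompactSupport g) :
    dZbar (cauchyTransform g) = cauchyTransform (dZbar g) := by
  ext z
  have h v := continuous_fderiv_apply_const hg v
  have h' v := hc.fderiv_apply ℝ v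
  rw [dZbar_eq g, cauchyTransform_add ((h 1).const_mul _) (h' 1).mul_left ((h I).const_mul _)
    (h' I).mul_left, cauchyTransform_const_mul, cauchyTransform_const_mul, dZbar_eq]
  simp only [fderiv_cauchyTransform hg hc]

theorem exists_forall_le_norm_imp_eq_zero {g : ℂ → ℂ} (hc : HasCompactSupport g) :
    ∃ R : ℝ, 0 < R ∧ ∀ z, R ≤ ‖z‖ → g z = 0 := by
  obtain ⟨R, hR⟩ := hc.isCompact.isBounded.subset_ball 0
  refine ⟨max R 1, by positivity, fun z hz => ?_⟩
  by_contra h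
  have := hR (subset_tsupport g h)
  rw [mem_ball_zero_iff] at this
  exact absurd (le_max_left R 1) (by linarith)

/-- The point `e^{iθ}` of the unit circle. -/
noncomputable abbrev eI (θ : ℝ) : ℂ := Real.cos θ + Real.sin θ * I

theorem norm_eI (θ : ℝ) : ‖eI θ‖ = 1 := by
  simp [eI, Complex.norm_cos_add_sin_mul_I]

theorem hasDerivAt_eI (θ : ℝ) : HasDerivAt eI (I * eI θ) θ := by
  have h1 := (Real.hasDerivAt_cos θ).ofReal_comp
  have h2 := ((Real.hasDerivAt_sin θ).ofReal_comp).mul_const I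
  convert! h1.add h2 using 1
  simp only [eI, ofReal_neg]
  linear_combination (Real.sin θ : ℂ) * I_mul_I

theorem continuous_eI : Continuous eI := by
  unfold eI; fun_prop

theorem integrableOn_polar {g : ℂ → ℂ} (hg : ContDiff ℝ 1 g)
    (hc : HasCompactSupport g) (z : ℂ) (c : ℂ) :
    IntegrableOn (fun p : ℝ × ℝ => fderiv ℝ g (z - p.1 * eI p.2) (c * eI p.2))
      (Ioi 0 ×ˢ Ioo (-Real.pi) Real.pi) := by
  obtain ⟨R, hR, hz⟩ := exists_forall_le_norm_imp_eq_zero hc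
  have hcont : Continuous (fun p : ℝ × ℝ => fderiv ℝ g (z - p.1 * eI p.2) (c * eI p.2)) := by
    have h0 : Continuous fun p : ℝ × ℝ => eI p.2 := continuous_eI.comp continuous_snd
    refine Continuous.clm_apply ((hg.continuous_fderiv one_ne_zero).comp ?_)
      (continuous_const.mul h0)
    exact continuous_const.sub ((Complex.continuous_ofReal.comp continuous_fst).mul h0)
  have h1 : IntegrableOn (fun p : ℝ × ℝ => fderiv ℝ g (z - p.1 * eI p.2) (c * eI p.2))
      (Icc 0 (R + ‖z‖ + 1) ×ˢ Icc (-Real.pi) Real.pi) :=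
    hcont.continuousOn.integrableOn_compact (isCompact_Icc.prod isCompact_Icc)
  refine h1.of_forall_sdiff_eq_zero (measurableSet_Ioi.prod measurableSet_Ioo) ?_
  rintro ⟨r, θ⟩ ⟨⟨hr, hθ⟩, hn⟩
  have hr' : R + ‖z‖ + 1 < r := by
    by_contra h
    exact hn ⟨⟨le_of_lt hr, not_lt.1 h⟩, Ioo_subset_Icc_self hθ⟩
  have hfd : fderiv ℝ g (z - r * eI θ) = 0 := by
    by_contra h
    have hmem : z - r * eI θ ∈ tsupport g := support_fderiv_subset ℝ h
    have hcl : tsupport g ⊆ closedBall 0 R := by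
      refine closure_minimal (fun w hw => ?_) isClosed_closedBall
      by_contra h'
      rw [mem_closedBall_zero_iff, not_le] at h'
      exact hw (hz w h'.le)
    have h2 := hcl hmem
    rw [mem_closedBall_zero_iff] at h2
    have h3 : ‖(r : ℂ) * eI θ‖ = r := by
      rw [norm_mul, norm_eI, mul_one, norm_real, Real.norm_of_nonneg (le_of_lt hr)]
    have h4 := norm_sub_norm_le ((r : ℂ) * eI θ) z
    rw [norm_sub_rev, h3] at h4
    linarith
  simp [hfd]

/-- **Cauchy–Pompeiu formula** for compactly supported functions. -/
theorem cauchyTransform_dZbar {g : ℂ → ℂ} (hg : ContDiff ℝ 1 g) (hc : HasCompactSupport g) :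
    cauchyTransform (dZbar g) = g := by
  ext z
  have hd : Differentiable ℝ g := hg.differentiable one_ne_zero
  have hpi : (Real.pi : ℂ) ≠ 0 := by exact_mod_cast Real.pi_pos.ne'
  rw [cauchyTransform_apply, ← Complex.integral_comp_polarCoord_symm, polarCoord_target]
  have key : ∀ p ∈ Ioi (0 : ℝ) ×ˢ Ioo (-Real.pi) Real.pi,
      p.1 • (cauchyKernel (Complex.polarCoord.symm p) * dZbar g (z - Complex.polarCoord.symm p)) =
      (2 * (Real.pi : ℂ))⁻¹ * fderiv ℝ g (z - p.1 * eI p.2) (1 * eI p.2) +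
      (2 * (Real.pi : ℂ))⁻¹ * I * fderiv ℝ g (z - p.1 * eI p.2) (I * eI p.2) := by
    rintro ⟨r, θ⟩ ⟨hr, -⟩
    have hr0 : (r : ℂ) ≠ 0 := by exact_mod_cast (ne_of_gt hr)
    have he : eI θ ≠ 0 := by
      intro h; have := norm_eI θ; simp [h] at this
    rw [Complex.polarCoord_symm_apply]
    change r • (cauchyKernel (r * eI θ) * dZbar g (z - r * eI θ)) = _
    simp only
    set L := fderiv ℝ g (z - r * eI θ) with hL
    have hlin : ∀ a b : ℝ, L (a + b * I) = a * L 1 + b * L I := by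
      intro a b
      have : (a + b * I : ℂ) = a • (1 : ℂ) + b • I := by simp
      rw [this, map_add, map_smul, map_smul]; simp
    have e1 : L (1 * eI θ) = Real.cos θ * L 1 + Real.sin θ * L I := by
      rw [one_mul]; exact hlin _ _
    have e2 : L (I * eI θ) = -Real.sin θ * L 1 + Real.cos θ * L I := by
      have : I * eI θ = (((-Real.sin θ : ℝ) : ℂ) + (Real.cos θ : ℝ) * I) := by
        simp only [eI, ofReal_neg]
        linear_combination (Real.sin θ : ℂ) * I_mul_I
      rw [this, hlin]; push_cast; ring
    have hinv : (eI θ)⁻¹ = Real.cos θ - Real.sin θ * I := by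
      rw [inv_eq_iff_eq_inv, eq_comm, inv_eq_iff_eq_inv, ← one_div, eq_div_iff he]
      simp only [eI]
      have : (Real.cos θ : ℂ) ^ 2 + (Real.sin θ : ℂ) ^ 2 = 1 := by
        exact_mod_cast Real.cos_sq_add_sin_sq θ
      linear_combination this - (Real.sin θ : ℂ) ^ 2 * I_mul_I
    rw [e1, e2]
    simp only [dZbar, ← hL, cauchyKernel, mul_inv, hinv, real_smul]
    have hrr : (r : ℂ) * (r : ℂ)⁻¹ = 1 := mul_inv_cancel₀ hr0
    have : (r : ℂ) * ((Real.pi : ℂ)⁻¹ * ((r : ℂ)⁻¹ * (Real.cos θ - Real.sin θ * I)) *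
        ((L 1 + I * L I) / 2)) = (r : ℂ) * (r : ℂ)⁻¹ * (Real.pi : ℂ)⁻¹ *
        (Real.cos θ - Real.sin θ * I) * ((L 1 + I * L I) / 2) := by ring
    rw [this, hrr]
    have h2 : (2 : ℂ)⁻¹ = 1 / 2 := by norm_num
    rw [h2]
    linear_combination (-(1 / 2) * (Real.pi : ℂ)⁻¹ * Real.sin θ * L I) * I_mul_I
  have hA := integrableOn_polar hg hc z 1
  have hB := integrableOn_polar hg hc z I
  rw [setIntegral_congr_fun (measurableSet_Ioi.prod measurableSet_Ioo) key,
    integral_add (hA.const_mul _) (hB.const_mul _), integral_const_mul, integral_const_mul]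
  have iB : ∫ p in Ioi (0 : ℝ) ×ˢ Ioo (-Real.pi) Real.pi,
      fderiv ℝ g (z - p.1 * eI p.2) (I * eI p.2) = 0 := by
    rw [Measure.volume_eq_prod, setIntegral_prod _ hB]
    rw [setIntegral_congr_fun (g := fun _ => (0 : ℂ)) measurableSet_Ioi]
    · simp
    intro r hr
    have hr0 : (r : ℂ) ≠ 0 := by exact_mod_cast (ne_of_gt hr)
    have hder : ∀ θ : ℝ, HasDerivAt (fun θ : ℝ => -(r : ℂ)⁻¹ * g (z - r * eI θ))
        (fderiv ℝ g (z - r * eI θ) (I * eI θ)) θ := by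
      intro θ
      have h1 : HasDerivAt (fun θ : ℝ => z - r * eI θ) (-(r * (I * eI θ))) θ :=
        ((hasDerivAt_eI θ).const_mul (r : ℂ)).const_sub z
      have h2 := ((hd (z - r * eI θ)).hasFDerivAt.comp_hasDerivAt θ h1).const_mul (-(r : ℂ)⁻¹)
      convert! h2 using 1
      have : -((r : ℂ) * (I * eI θ)) = (-r : ℝ) • (I * eI θ) := by simp
      rw [this, map_smul, real_smul]
      push_cast
      field_simp
    have hle : -Real.pi ≤ Real.pi := by linarith [Real.pi_pos]
    change ∫ θ in Ioo (-Real.pi) Real.pi, fderiv ℝ g (z - r * eI θ) (I * eI θ) = 0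
    rw [← integral_Ioc_eq_integral_Ioo, ← intervalIntegral.integral_of_le hle,
      intervalIntegral.integral_eq_sub_of_hasDerivAt (fun θ _ => hder θ)]
    · simp [eI]
    · refine Continuous.intervalIntegrable ?_ _ _
      refine Continuous.clm_apply ((hg.continuous_fderiv one_ne_zero).comp ?_)
        (continuous_const.mul continuous_eI)
      exact continuous_const.sub (continuous_const.mul continuous_eI)
  have iA : ∫ p in Ioi (0 : ℝ) ×ˢ Ioo (-Real.pi) Real.pi,
      fderiv ℝ g (z - p.1 * eI p.2) (1 * eI p.2) = 2 * Real.pi * g z := by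
    have hA' : Integrable (fun p : ℝ × ℝ => fderiv ℝ g (z - p.1 * eI p.2) (1 * eI p.2))
        ((volume.restrict (Ioi 0)).prod (volume.restrict (Ioo (-Real.pi) Real.pi))) := by
      rw [Measure.prod_restrict]; exact hA
    rw [Measure.volume_eq_prod, ← Measure.prod_restrict, integral_prod_symm _ hA']
    have : ∀ θ : ℝ, ∫ r in Ioi (0 : ℝ), fderiv ℝ g (z - r * eI θ) (1 * eI θ) = g z := by
      intro θ
      have hder : ∀ r : ℝ, HasDerivAt (fun r : ℝ => g (z - r * eI θ))
          (-fderiv ℝ g (z - r * eI θ) (1 * eI θ)) r := by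
        intro r
        have h1 : HasDerivAt (fun r : ℝ => z - r * eI θ) (-(1 * eI θ)) r := by
          have := ((hasDerivAt_id r).ofReal_comp.mul_const (eI θ)).const_sub z
          simpa using this
        have h2 := (hd (z - r * eI θ)).hasFDerivAt.comp_hasDerivAt r h1
        rw [map_neg] at h2
        exact h2
      obtain ⟨R, hR, hz⟩ := exists_forall_le_norm_imp_eq_zero hc
      have hcs : HasCompactSupport (fun r : ℝ => g (z - r * eI θ)) := by
        refine HasCompactSupport.intro (isCompact_closedBall (0 : ℝ) (R + ‖z‖)) fun r hr => ?_
        rw [mem_closedBall_zero_iff, not_le] at hr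
        refine hz _ ?_
        have h3 : ‖(r : ℂ) * eI θ‖ = ‖r‖ := by rw [norm_mul, norm_eI, mul_one, norm_real]
        have h4 := norm_sub_norm_le ((r : ℂ) * eI θ) z
        rw [norm_sub_rev, h3] at h4
        linarith
      have hcd : ContDiff ℝ 1 (fun r : ℝ => g (z - r * eI θ)) := by
        refine hg.comp (contDiff_const.sub ?_)
        exact (ofRealCLM.contDiff).mul contDiff_const
      have h5 := hcs.integral_Ioi_deriv_eq hcd 0
      simp only [fun r => (hder r).deriv, integral_neg] at h5
      simpa using h5
    simp only [this]
    simp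
    ring_nf
    left
    rw [max_eq_left (by positivity)]
    push_cast; ring
  rw [iA, iB]
  field_simp
  simp

theorem dZbar_cauchyTransform_eq_self {g : ℂ → ℂ} (hg : ContDiff ℝ 1 g)
    (hc : HasCompactSupport g) : dZbar (cauchyTransform g) = g := by
  rw [dZbar_cauchyTransform hg hc, cauchyTransform_dZbar hg hc]

theorem norm_cauchyKernel_le (w : ℂ) : ‖cauchyKernel w‖ ≤ ‖w‖⁻¹ := by
  rw [norm_cauchyKernel, mul_inv]
  have : Real.pi⁻¹ ≤ 1 := inv_le_one_of_one_le₀ (by linarith [Real.pi_gt_three])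
  exact mul_le_of_le_one_left (by positivity) this

theorem exists_norm_cauchyTransform_le (R : ℝ) : ∃ C : ℝ, 0 ≤ C ∧
    ∀ (g : ℂ → ℂ) (M : ℝ), (∀ z, R ≤ ‖z‖ → g z = 0) → (∀ z, ‖g z‖ ≤ M) →
      ∀ z, ‖cauchyTransform g z‖ ≤ C * M := by
  set A := ∫ w in ball (0 : ℂ) 1, ‖cauchyKernel w‖ with hA
  have hA0 : 0 ≤ A := integral_nonneg fun w => norm_nonneg _
  refine ⟨A + volume.real (ball (0 : ℂ) R), by positivity, fun g M hg hM z => ?_⟩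
  have hM0 : 0 ≤ M := (norm_nonneg _).trans (hM 0)
  have hb : volume.real (ball (0 : ℂ) R) = volume.real (ball z R) := by
    simp [Measure.real, Measure.addHaar_ball_center volume z R]
  have i1 : Integrable ((ball (0 : ℂ) 1).indicator fun w => ‖cauchyKernel w‖) :=
    (integrable_indicator_iff measurableSet_ball).2 (integrableOn_cauchyKernel_ball 1).norm
  have i2 : Integrable ((ball z R).indicator fun _ => (1 : ℝ)) :=
    (integrable_indicator_iff measurableSet_ball).2
      (integrableOn_const (measure_ball_lt_top.ne))
  rw [cauchyTransform_apply]
  refine (norm_integral_le_of_norm_le ((i1.add i2).mul_const M)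
    (Eventually.of_forall fun w => ?_)).trans_eq ?_
  · by_cases hw : w ∈ ball z R
    · rw [norm_mul]
      refine mul_le_mul ?_ (hM _) (norm_nonneg _) ?_
      · simp only [Pi.add_apply, indicator_of_mem hw]
        by_cases h1 : w ∈ ball (0 : ℂ) 1
        · rw [indicator_of_mem h1]; linarith
        · rw [indicator_of_notMem h1, zero_add]
          rw [mem_ball_zero_iff, not_lt] at h1
          exact (norm_cauchyKernel_le w).trans (inv_le_one_of_one_le₀ h1)
      · exact add_nonneg (indicator_nonneg (fun _ _ => norm_nonneg _) _)
          (indicator_nonneg (fun _ _ => zero_le_one) _)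
    · rw [hg (z - w), mul_zero, norm_zero]
      · exact mul_nonneg (add_nonneg (indicator_nonneg (fun _ _ => norm_nonneg _) _)
          (indicator_nonneg (fun _ _ => zero_le_one) _)) hM0
      · rw [mem_ball_iff_norm', not_lt] at hw; exact hw
  · rw [integral_mul_const]
    simp only [Pi.add_apply]
    rw [integral_add i1 i2, integral_indicator measurableSet_ball,
      integral_indicator measurableSet_ball, hb]
    simp [hA]

theorem exists_norm_le_of_bounded_of_tail {F : ℂ → ℂ} {M A R : ℝ} (k : ℕ)
    (hM : ∀ z, ‖F z‖ ≤ M) (hR : 1 ≤ R) (hA : ∀ z, R ≤ ‖z‖ → ‖F z‖ ≤ A * (‖z‖ ^ k)⁻¹) :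
    ∃ C, 0 ≤ C ∧ ∀ z, ‖F z‖ ≤ C * ((1 + ‖z‖) ^ k)⁻¹ := by
  have hM0 : 0 ≤ M := (norm_nonneg _).trans (hM 0)
  refine ⟨M * (1 + R) ^ k + |A| * 2 ^ k, by positivity, fun z => ?_⟩
  rw [← div_eq_mul_inv, le_div_iff₀ (by positivity)]
  rcases le_total R ‖z‖ with h | h
  · have h0 : 0 < ‖z‖ := by linarith
    have h1 : (1 + ‖z‖) ^ k ≤ (2 * ‖z‖) ^ k := by gcongr; linarith
    have h2 : ‖F z‖ * ‖z‖ ^ k ≤ A := by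
      have := hA z h
      rwa [← div_eq_mul_inv, le_div_iff₀ (by positivity)] at this
    calc ‖F z‖ * (1 + ‖z‖) ^ k ≤ ‖F z‖ * (2 * ‖z‖) ^ k := by gcongr
      _ = (‖F z‖ * ‖z‖ ^ k) * 2 ^ k := by rw [mul_pow]; ring
      _ ≤ |A| * 2 ^ k := by gcongr; exact h2.trans (le_abs_self A)
      _ ≤ _ := by have : 0 ≤ M * (1 + R) ^ k := by positivity
                  linarith
  · calc ‖F z‖ * (1 + ‖z‖) ^ k ≤ M * (1 + R) ^ k := by gcongr; exact hM z
      _ ≤ _ := by have : 0 ≤ |A| * 2 ^ k := by positivity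
                  linarith

theorem exists_norm_le_of_continuous {g : ℂ → ℂ} (hg : Continuous g) (hc : HasCompactSupport g) :
    ∃ M : ℝ, ∀ z, ‖g z‖ ≤ M :=
  hg.bounded_above_of_compact_support hc

theorem half_norm_le_of_norm_sub_lt {R : ℝ} {z w : ℂ} (hz : 2 * R ≤ ‖z‖) (h : ‖z - w‖ < R) :
    ‖z‖ / 2 ≤ ‖w‖ := by
  have := norm_sub_norm_le z w
  linarith

theorem exists_cauchyTransform_decay {g : ℂ → ℂ} (hg : Continuous g) (hc : HasCompactSupport g) :
    ∃ C, 0 ≤ C ∧ ∀ z, ‖cauchyTransform g z‖ ≤ C * ((1 + ‖z‖) ^ 1)⁻¹ := by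
  obtain ⟨R, hR0, hR⟩ := exists_forall_le_norm_imp_eq_zero hc
  obtain ⟨M, hM⟩ := exists_norm_le_of_continuous hg hc
  obtain ⟨C, -, hC⟩ := exists_norm_cauchyTransform_le R
  have hi : Integrable g := hg.integrable_of_hasCompactSupport hc
  refine exists_norm_le_of_bounded_of_tail (M := C * M) (A := 2 * ∫ w, ‖g w‖) (R := 2 * R + 1) 1
    (hC g M hR hM) (by linarith) fun z hz => ?_
  have hz0 : 0 < ‖z‖ := by linarith
  rw [cauchyTransform_apply]
  have hi' : Integrable fun w => ‖g (z - w)‖ := (hi.comp_sub_left z).norm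
  refine (norm_integral_le_of_norm_le (hi'.const_mul (2 * ‖z‖⁻¹))
    (Eventually.of_forall fun w => ?_)).trans_eq ?_
  · rw [norm_mul]
    rcases lt_or_ge ‖z - w‖ R with h | h
    · have := half_norm_le_of_norm_sub_lt (by linarith) h
      gcongr
      refine (norm_cauchyKernel_le w).trans ?_
      calc ‖w‖⁻¹ ≤ (‖z‖ / 2)⁻¹ := by gcongr
        _ = 2 * ‖z‖⁻¹ := by rw [inv_div, div_eq_mul_inv]
    · simp [hR _ h]
  · rw [integral_const_mul, integral_sub_left_eq_self (fun w => ‖g w‖)]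
    ring

theorem exists_cauchyTransform_decay_sq {g : ℂ → ℂ} (hg : Continuous g)
    (hc : HasCompactSupport g) (h0 : ∫ w, g w = 0) :
    ∃ C, 0 ≤ C ∧ ∀ z, ‖cauchyTransform g z‖ ≤ C * ((1 + ‖z‖) ^ 2)⁻¹ := by
  obtain ⟨R, hR0, hR⟩ := exists_forall_le_norm_imp_eq_zero hc
  obtain ⟨M, hM⟩ := exists_norm_le_of_continuous hg hc
  obtain ⟨C, -, hC⟩ := exists_norm_cauchyTransform_le R
  have hi : Integrable g := hg.integrable_of_hasCompactSupport hc
  refine exists_norm_le_of_bounded_of_tail (M := C * M) (A := 2 * R * ∫ w, ‖g w‖)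
    (R := 2 * R + 1) 2 (hC g M hR hM) (by linarith) fun z hz => ?_
  have hz0 : 0 < ‖z‖ := by linarith
  have e : cauchyTransform g z = ∫ w, (cauchyKernel w - cauchyKernel z) * g (z - w) := by
    simp only [sub_mul]
    rw [integral_sub (integrable_cauchyTransform_integrand hg hc z)
      ((hi.comp_sub_left z).const_mul _), integral_const_mul,
      integral_sub_left_eq_self g, h0, mul_zero, sub_zero, cauchyTransform_apply]
  rw [e]
  have hi' : Integrable fun w => ‖g (z - w)‖ := (hi.comp_sub_left z).norm
  refine (norm_integral_le_of_norm_le (hi'.const_mul (2 * R * (‖z‖ ^ 2)⁻¹))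
    (Eventually.of_forall fun w => ?_)).trans_eq ?_
  · rw [norm_mul]
    rcases lt_or_ge ‖z - w‖ R with h | h
    · have h2 := half_norm_le_of_norm_sub_lt (by linarith) h
      gcongr
      have hw0 : 0 < ‖w‖ := by linarith
      have hz' : z ≠ 0 := norm_pos_iff.1 hz0
      have hw' : w ≠ 0 := norm_pos_iff.1 hw0
      have hpi : (Real.pi : ℂ) ≠ 0 := by exact_mod_cast Real.pi_pos.ne'
      have : cauchyKernel w - cauchyKernel z = (z - w) * cauchyKernel w * z⁻¹ := by
        simp only [cauchyKernel]; field_simp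
      rw [this, norm_mul, norm_mul, norm_inv]
      calc ‖z - w‖ * ‖cauchyKernel w‖ * ‖z‖⁻¹ ≤ R * (‖z‖ / 2)⁻¹ * ‖z‖⁻¹ := by
            gcongr
            exact (norm_cauchyKernel_le w).trans (by gcongr)
        _ = _ := by field_simp
    · simp [hR _ h]
  · rw [integral_const_mul, integral_sub_left_eq_self (fun w => ‖g w‖)]
    ring

theorem integrable_of_decay {E : Type*} [NormedAddCommGroup E] {F : ℂ → E} (hF : Continuous F)
    {C : ℝ} {k : ℕ} (hk : 3 ≤ k)
    (h : ∀ z, ‖F z‖ ≤ C * ((1 + ‖z‖) ^ k)⁻¹) : Integrable F := by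
  have h1 : Integrable fun z : ℂ => (1 + ‖z‖) ^ (-(k : ℝ)) := by
    refine integrable_one_add_norm ?_
    rw [Complex.finrank_real_complex]
    exact_mod_cast hk
  refine (h1.const_mul C).mono' hF.aestronglyMeasurable (Eventually.of_forall fun z => ?_)
  rw [Real.rpow_neg (by positivity), Real.rpow_natCast]
  exact h z

theorem integral_fderiv_apply_eq_zero {g : ℂ → ℂ} (hg : ContDiff ℝ 1 g)
    (hc : HasCompactSupport g) (v : ℂ) : ∫ z, fderiv ℝ g z v = 0 := by
  have hgi : Integrable g := hg.continuous.integrable_of_hasCompactSupport hc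
  have hgi' : Integrable fun z => fderiv ℝ g z v :=
    (continuous_fderiv_apply_const hg v).integrable_of_hasCompactSupport (hc.fderiv_apply ℝ v)
  have := integral_bilinear_hasFDerivAt_right_eq_neg_left_of_integrable (μ := volume)
    (B := ContinuousLinearMap.mul ℝ ℂ) (f := fun _ : ℂ => (1 : ℂ)) (f' := 0)
    (g := g) (g' := fderiv ℝ g) (v := v) (by simp) (by simpa using hgi') (by simpa using hgi)
    (fun x _ => hasFDerivAt_const _ _)
    (fun x _ => (hg.differentiable one_ne_zero x).hasFDerivAt)
  simpa using this

theorem exists_cauchyTransform_fderiv_decay {g : ℂ → ℂ} (hg : ContDiff ℝ 1 g)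
    (hc : HasCompactSupport g) (v : ℂ) :
    ∃ C, 0 ≤ C ∧ ∀ z, ‖cauchyTransform (fun w => fderiv ℝ g w v) z‖ ≤ C * ((1 + ‖z‖) ^ 2)⁻¹ :=
  exists_cauchyTransform_decay_sq (continuous_fderiv_apply_const hg v) (hc.fderiv_apply ℝ v)
    (integral_fderiv_apply_eq_zero hg hc v)

theorem contDiff_fderiv_apply_const {n m : ℕ∞} {f : ℂ → ℂ} (hf : ContDiff ℝ n f)
    (hmn : (m : WithTop ℕ∞) + 1 ≤ n) (v : ℂ) : ContDiff ℝ m fun z => fderiv ℝ f z v :=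
  (hf.fderiv_right hmn).clm_apply contDiff_const

theorem fderiv_fderiv_apply_comm {f : ℂ → ℂ} (hf : ContDiff ℝ 2 f) (z v w : ℂ) :
    fderiv ℝ (fun x => fderiv ℝ f x v) z w = fderiv ℝ (fun x => fderiv ℝ f x w) z v := by
  have hd : DifferentiableAt ℝ (fderiv ℝ f) z :=
    (hf.fderiv_right (m := 1) (by norm_num)).differentiable one_ne_zero z
  have h := (hf.contDiffAt (x := z)).isSymmSndFDerivAt (by simp)
  have e : ∀ a b : ℂ, fderiv ℝ (fun x => fderiv ℝ f x a) z b = fderiv ℝ (fderiv ℝ f) z b a := by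
    intro a b
    rw [fderiv_clm_apply hd (differentiableAt_const a)]
    simp
  rw [e, e, h.eq]

theorem norm_mul_decay {a b : ℂ} {A B t : ℝ} {j k : ℕ} (hA : 0 ≤ A)
    (ht : 0 < t) (ha : ‖a‖ ≤ A * (t ^ j)⁻¹) (hb : ‖b‖ ≤ B * (t ^ k)⁻¹) :
    ‖a * (starRingEnd ℂ) b‖ ≤ A * B * (t ^ (j + k))⁻¹ := by
  rw [norm_mul, RCLike.norm_conj]
  calc ‖a‖ * ‖b‖ ≤ (A * (t ^ j)⁻¹) * (B * (t ^ k)⁻¹) := by gcongr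
    _ = _ := by rw [pow_add, mul_inv]; ring

/-- Moving a derivative across the Hermitian pairing of first derivatives of a Cauchy transform. -/
theorem integral_cauchyTransform_fderiv_mul_conj {g : ℂ → ℂ} (hg : ContDiff ℝ 2 g)
    (hc : HasCompactSupport g) (v w : ℂ) :
    ∫ z, cauchyTransform (fun x => fderiv ℝ g x v) z *
        (starRingEnd ℂ) (cauchyTransform (fun x => fderiv ℝ g x w) z) =
      -∫ z, cauchyTransform (fun x => fderiv ℝ (fun y => fderiv ℝ g y v) x w) z *
        (starRingEnd ℂ) (cauchyTransform g z) := by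
  have hg1 : ContDiff ℝ 1 g := hg.of_le (by norm_num)
  have hgv : ContDiff ℝ 1 fun x => fderiv ℝ g x v :=
    contDiff_fderiv_apply_const (n := 2) (m := 1) hg (by norm_num) v
  have hcv : HasCompactSupport fun x => fderiv ℝ g x v := hc.fderiv_apply ℝ v
  have hcw : HasCompactSupport fun x => fderiv ℝ g x w := hc.fderiv_apply ℝ w
  have hcvw : HasCompactSupport fun x => fderiv ℝ (fun y => fderiv ℝ g y v) x w :=
    hcv.fderiv_apply ℝ w
  have c0 := continuous_cauchyTransform hg.continuous hc
  have cv := continuous_cauchyTransform (continuous_fderiv_apply_const hg1 v) hcv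
  have cw := continuous_cauchyTransform (continuous_fderiv_apply_const hg1 w) hcw
  have cvw := continuous_cauchyTransform (continuous_fderiv_apply_const hgv w) hcvw
  obtain ⟨C0, p0, d0⟩ := exists_cauchyTransform_decay hg.continuous hc
  obtain ⟨Cv, pv, dv⟩ := exists_cauchyTransform_fderiv_decay hg1 hc v
  obtain ⟨Cw, pw, dw⟩ := exists_cauchyTransform_fderiv_decay hg1 hc w
  obtain ⟨Cvw, pvw, dvw⟩ := exists_cauchyTransform_fderiv_decay hgv hcv w
  have conj_cont := Complex.continuous_conj
  have hder : ∀ z, HasFDerivAt (fun z => (starRingEnd ℂ) (cauchyTransform g z))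
      ((conjCLE : ℂ →L[ℝ] ℂ).comp (fderiv ℝ (cauchyTransform g) z)) z := fun z =>
    (conjCLE : ℂ →L[ℝ] ℂ).hasFDerivAt.comp z
      ((contDiff_cauchyTransform (n := 1) hg1 hc).differentiable one_ne_zero z).hasFDerivAt
  have := integral_bilinear_hasFDerivAt_right_eq_neg_left_of_integrable (μ := volume)
    (B := ContinuousLinearMap.mul ℝ ℂ) (f := cauchyTransform (fun x => fderiv ℝ g x v))
    (f' := fderiv ℝ (cauchyTransform (fun x => fderiv ℝ g x v)))
    (g := fun z => (starRingEnd ℂ) (cauchyTransform g z))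
    (g' := fun z => (conjCLE : ℂ →L[ℝ] ℂ).comp (fderiv ℝ (cauchyTransform g) z)) (v := w)
    ?_ ?_ ?_
    (fun x _ => ((contDiff_cauchyTransform (n := 1) hgv hcv).differentiable
      one_ne_zero x).hasFDerivAt)
    (fun x _ => hder x)
  · simpa [fderiv_cauchyTransform hg1 hc, fderiv_cauchyTransform hgv hcv] using this
  · simp only [ContinuousLinearMap.mul_apply', fderiv_cauchyTransform hgv hcv]
    exact integrable_of_decay (cvw.mul (conj_cont.comp c0)) (le_refl 3)
      fun z => norm_mul_decay pvw (by positivity) (dvw z) (d0 z)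
  · simp only [ContinuousLinearMap.mul_apply', ContinuousLinearMap.comp_apply,
      fderiv_cauchyTransform hg1 hc]
    exact integrable_of_decay (cv.mul (conj_cont.comp cw)) (by norm_num : 3 ≤ 2 + 2)
      fun z => norm_mul_decay pv (by positivity) (dv z) (dw z)
  · exact integrable_of_decay (cv.mul (conj_cont.comp c0)) (le_refl 3)
      fun z => norm_mul_decay pv (by positivity) (dv z) (d0 z)

theorem continuous_dZ {f : ℂ → ℂ} (hf : ContDiff ℝ 1 f) : Continuous (dZ f) := by
  rw [dZ_eq]
  exact ((continuous_fderiv_apply_const hf 1).const_mul _).add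
    ((continuous_fderiv_apply_const hf I).const_mul _)

theorem norm_dZ_sq_sub (f : ℂ → ℂ) (z : ℂ) :
    ‖dZ f z‖ ^ 2 - ‖dZbar f z‖ ^ 2 =
      -(fderiv ℝ f z 1 * (starRingEnd ℂ) (fderiv ℝ f z I)).im := by
  simp only [← Complex.normSq_eq_norm_sq, dZ, dZbar, Complex.normSq_apply]
  simp
  ring

/-- The Beurling transform `∂_z ∘ (1/(π z) ⋆ ·)` is an isometry for the `L²` norm. -/
theorem integral_norm_dZ_cauchyTransform_sq {g : ℂ → ℂ} (hg : ContDiff ℝ 2 g)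
    (hc : HasCompactSupport g) :
    Integrable (fun z => ‖dZ (cauchyTransform g) z‖ ^ 2) ∧
      ∫ z, ‖dZ (cauchyTransform g) z‖ ^ 2 = ∫ z, ‖g z‖ ^ 2 := by
  have hg1 : ContDiff ℝ 1 g := hg.of_le (by norm_num)
  set p := cauchyTransform (fun x => fderiv ℝ g x 1) with hp
  set q := cauchyTransform (fun x => fderiv ℝ g x I) with hq
  have cp : Continuous p :=
    continuous_cauchyTransform (continuous_fderiv_apply_const hg1 1) (hc.fderiv_apply ℝ 1)
  have cq : Continuous q :=
    continuous_cauchyTransform (continuous_fderiv_apply_const hg1 I) (hc.fderiv_apply ℝ I)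
  obtain ⟨Cp, hCp, dp⟩ := exists_cauchyTransform_fderiv_decay hg1 hc 1
  obtain ⟨Cq, hCq, dq⟩ := exists_cauchyTransform_fderiv_decay hg1 hc I
  have ipq : Integrable fun z => p z * (starRingEnd ℂ) (q z) :=
    integrable_of_decay (cp.mul (Complex.continuous_conj.comp cq)) (by norm_num : 3 ≤ 2 + 2)
      fun z => norm_mul_decay hCp (by positivity) (dp z) (dq z)
  have hsymm : ∫ z, p z * (starRingEnd ℂ) (q z) = ∫ z, q z * (starRingEnd ℂ) (p z) := by
    rw [integral_cauchyTransform_fderiv_mul_conj hg hc,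
      integral_cauchyTransform_fderiv_mul_conj hg hc]
    simp only [fun x => fderiv_fderiv_apply_comm hg x 1 I]
  have him : ∫ z, (p z * (starRingEnd ℂ) (q z)).im = 0 := by
    have h1 : ∫ z, q z * (starRingEnd ℂ) (p z) =
        (starRingEnd ℂ) (∫ z, p z * (starRingEnd ℂ) (q z)) := by
      rw [← integral_conj]
      congr 1; ext z; simp [mul_comm]
    rw [h1] at hsymm
    have h2 := Complex.conj_eq_iff_im.1 hsymm.symm
    have h3 := integral_im (𝕜 := ℂ) ipq
    simpa [h2] using h3
  have ii : Integrable fun z => (p z * (starRingEnd ℂ) (q z)).im := ipq.im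
  have hg0 := hg.continuous
  have hcs : HasCompactSupport fun z => ‖g z‖ ^ 2 :=
    hc.comp_left (g := fun t : ℂ => ‖t‖ ^ 2) (by simp)
  have cg : Continuous fun z => ‖g z‖ ^ 2 := by fun_prop
  have ig : Integrable fun z => ‖g z‖ ^ 2 := cg.integrable_of_hasCompactSupport hcs
  have e : ∀ z, ‖dZ (cauchyTransform g) z‖ ^ 2 =
      ‖g z‖ ^ 2 - (p z * (starRingEnd ℂ) (q z)).im := by
    intro z
    have h := norm_dZ_sq_sub (cauchyTransform g) z
    rw [dZbar_cauchyTransform_eq_self hg1 hc, fderiv_cauchyTransform hg1 hc,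
      fderiv_cauchyTransform hg1 hc, ← hp, ← hq] at h
    linarith
  simp only [e]
  refine ⟨ig.sub ii, ?_⟩
  rw [integral_sub ig ii, him, sub_zero]

theorem lpNorm_two_eq {f : ℂ → ℂ} (hf : Continuous f) :
    lpNorm f 2 volume = √(∫ z, ‖f z‖ ^ 2) := by
  rw [lpNorm_eq_integral_norm_rpow_toReal (by simp) (by simp) hf.aestronglyMeasurable]
  simp [Real.sqrt_eq_rpow]

theorem lpNorm_mul_dZ_cauchyTransform_le {g φ : ℂ → ℂ} (hg : ContDiff ℝ 2 g)
    (hc : HasCompactSupport g) (hφ : Continuous φ) {M : ℝ} (hM : ∀ z, ‖φ z‖ ≤ M) :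
    lpNorm (fun z => φ z * dZ (cauchyTransform g) z) 2 volume ≤ M * lpNorm g 2 volume := by
  have hM0 : 0 ≤ M := (norm_nonneg _).trans (hM 0)
  have hT : Continuous (dZ (cauchyTransform g)) :=
    continuous_dZ (contDiff_cauchyTransform (n := 1) (hg.of_le (by norm_num)) hc)
  obtain ⟨h1, h2⟩ := integral_norm_dZ_cauchyTransform_sq hg hc
  rw [lpNorm_two_eq (f := fun z => φ z * dZ (cauchyTransform g) z) (hφ.mul hT),
    lpNorm_two_eq hg.continuous, ← h2]
  calc √(∫ z, ‖φ z * dZ (cauchyTransform g) z‖ ^ 2)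
      ≤ √(∫ z, M ^ 2 * ‖dZ (cauchyTransform g) z‖ ^ 2) := by
        refine Real.sqrt_le_sqrt (integral_mono_of_nonneg
          (Eventually.of_forall fun z => by positivity) (h1.const_mul _)
          (Eventually.of_forall fun z => ?_))
        simp only [norm_mul, mul_pow]
        gcongr
        exact hM z
    _ = M * √(∫ z, ‖dZ (cauchyTransform g) z‖ ^ 2) := by
        rw [integral_const_mul, Real.sqrt_mul (by positivity), Real.sqrt_sq hM0]

theorem norm_le_integral_norm_deriv {h : ℝ → ℂ} (hh : ContDiff ℝ 1 h) (hc : HasCompactSupport h)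
    (x : ℝ) : ‖h x‖ ≤ ∫ t, ‖deriv h t‖ := by
  rw [← hc.integral_Iic_deriv_eq hh x]
  refine (norm_integral_le_integral_norm _).trans
    (setIntegral_le_integral ?_ (Eventually.of_forall fun _ => norm_nonneg _))
  exact ((hh.continuous_deriv le_rfl).integrable_of_hasCompactSupport hc.deriv).norm

theorem hasCompactSupport_comp_line {g : ℂ → ℂ} (hc : HasCompactSupport g) {v w : ℂ}
    (hv : ‖v‖ = 1) : HasCompactSupport fun t : ℝ => g (w + t * v) := by
  obtain ⟨R, -, h⟩ := exists_forall_le_norm_imp_eq_zero hc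
  refine HasCompactSupport.intro (isCompact_closedBall (0 : ℝ) (R + ‖w‖)) fun t ht => h _ ?_
  have h1 : R + ‖w‖ < |t| := by simpa using ht
  have h2 : ‖(t : ℂ) * v‖ ≤ ‖w + t * v‖ + ‖w‖ := by
    simpa using norm_sub_le (w + t * v) w
  rw [norm_mul, hv, Complex.norm_real, Real.norm_eq_abs] at h2
  linarith

theorem norm_le_integral_norm_fderiv_line {g : ℂ → ℂ} (hg : ContDiff ℝ 1 g)
    (hc : HasCompactSupport g) {v w : ℂ} (hv : ‖v‖ = 1) (x : ℝ) :
    ‖g (w + x * v)‖ ≤ ∫ t : ℝ, ‖fderiv ℝ g (w + t * v) v‖ := by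
  have hl : ContDiff ℝ 1 fun t : ℝ => w + (t : ℂ) * v :=
    contDiff_const.add (Complex.ofRealCLM.contDiff.mul contDiff_const)
  have h := norm_le_integral_norm_deriv (hg.comp hl) (hasCompactSupport_comp_line hc hv) x
  have e : deriv (g ∘ fun t : ℝ => w + (t : ℂ) * v) =
      fun t : ℝ => fderiv ℝ g (w + t * v) v := by
    ext t
    have h1 : HasDerivAt (fun t : ℝ => w + (t : ℂ) * v) v t := by
      simpa using ((Complex.ofRealCLM.hasDerivAt (x := t)).mul_const v).const_add w
    exact ((hg.differentiable one_ne_zero _).hasFDerivAt.comp_hasDerivAt t h1).deriv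
  simpa only [e, Function.comp_apply] using h

theorem norm_le_integral_norm_fderiv_fderiv {g : ℂ → ℂ} (hg : ContDiff ℝ 2 g)
    (hc : HasCompactSupport g) (z : ℂ) :
    ‖g z‖ ≤ ∫ x, ‖fderiv ℝ (fun y => fderiv ℝ g y 1) x I‖ := by
  have hg1 : ContDiff ℝ 1 g := hg.of_le (by norm_num)
  have hd : ContDiff ℝ 1 fun y => fderiv ℝ g y 1 :=
    contDiff_fderiv_apply_const (n := 2) (m := 1) hg (by norm_num) 1
  have hdc : HasCompactSupport fun y => fderiv ℝ g y 1 := hc.fderiv_apply ℝ 1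
  set F : ℂ → ℂ := fun x => fderiv ℝ (fun y => fderiv ℝ g y 1) x I with hF
  have hFi : Integrable fun x => ‖F x‖ :=
    ((continuous_fderiv_apply_const hd I).integrable_of_hasCompactSupport
      (hdc.fderiv_apply ℝ I)).norm
  have hmp := Complex.volume_preserving_equiv_real_prod.symm
  have hFp : Integrable (fun p : ℝ × ℝ => ‖F (p.1 + p.2 * I)‖) (volume.prod volume) := by
    have := (hmp.integrable_comp_emb (MeasurableEquiv.measurableEmbedding _)).2 hFi
    refine this.congr (Eventually.of_forall fun p => ?_)
    simp [Complex.measurableEquivRealProd_symm_apply, Complex.mk_eq_add_mul_I]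
  have e : ∫ x, ‖F x‖ = ∫ t : ℝ, ∫ s : ℝ, ‖F (t + s * I)‖ := by
    rw [← hmp.integral_comp (MeasurableEquiv.measurableEmbedding _), Measure.volume_eq_prod,
      ← integral_prod _ hFp]
    simp [Complex.measurableEquivRealProd_symm_apply, Complex.mk_eq_add_mul_I]
  rw [e]
  have h1 := norm_le_integral_norm_fderiv_line hg1 hc (v := 1) (w := z.im * I) (by simp) z.re
  have hz : (z.im : ℂ) * I + z.re * 1 = z := by
    rw [mul_one, add_comm, Complex.re_add_im]
  rw [hz] at h1
  refine h1.trans (integral_mono_of_nonneg (Eventually.of_forall fun _ => norm_nonneg _)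
    hFp.integral_prod_left (Eventually.of_forall fun t => ?_))
  have h2 := norm_le_integral_norm_fderiv_line hd hdc (v := I) (w := t) (by simp) z.im
  simpa [add_comm] using h2

theorem exists_norm_le_lpNorm_fderiv_fderiv {S : Set ℂ} (hS : IsCompact S) :
    ∃ C, 0 ≤ C ∧ ∀ g : ℂ → ℂ, ContDiff ℝ 2 g → tsupport g ⊆ S → ∀ z,
      ‖g z‖ ≤ C * lpNorm (fun x => fderiv ℝ (fun y => fderiv ℝ g y 1) x I) 2 volume := by
  refine ⟨√(volume.real S), Real.sqrt_nonneg _, fun g hg hgS z => ?_⟩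
  have hc : HasCompactSupport g := hS.of_isClosed_subset (isClosed_tsupport g) hgS
  have hd : ContDiff ℝ 1 fun y => fderiv ℝ g y 1 :=
    contDiff_fderiv_apply_const (n := 2) (m := 1) hg (by norm_num) 1
  have hdc : HasCompactSupport fun y => fderiv ℝ g y 1 := hc.fderiv_apply ℝ 1
  set F : ℂ → ℂ := fun x => fderiv ℝ (fun y => fderiv ℝ g y 1) x I with hF
  have hFc : Continuous F := continuous_fderiv_apply_const hd I
  have hFs : HasCompactSupport F := hdc.fderiv_apply ℝ I
  have hF0 : ∀ x, x ∉ S → F x = 0 := by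
    intro x hx
    have h1 : tsupport F ⊆ tsupport g :=
      (tsupport_fderiv_apply_subset ℝ I).trans (tsupport_fderiv_apply_subset ℝ 1)
    exact image_eq_zero_of_notMem_tsupport fun h => hx (hgS (h1 h))
  have hSm : MeasurableSet S := hS.measurableSet
  have : IsFiniteMeasure (volume.restrict S) := ⟨by
    simpa using hS.measure_lt_top⟩
  have hmem : MemLp F 2 (volume.restrict S) :=
    (hFc.memLp_of_hasCompactSupport hFs).restrict S
  have cs := integral_mul_norm_le_Lp_mul_Lq (μ := volume.restrict S) (p := 2) (q := 2)
    (f := fun _ => (1 : ℂ)) (g := F) (by constructor <;> norm_num) (by simpa using memLp_const _)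
    (by simpa using hmem)
  refine (norm_le_integral_norm_fderiv_fderiv hg hc z).trans ?_
  rw [lpNorm_two_eq hFc]
  have e1 : ∫ x in S, ‖F x‖ = ∫ x, ‖F x‖ :=
    setIntegral_eq_integral_of_forall_compl_eq_zero fun x hx => by simp [hF0 x hx]
  have e2 : ∫ x in S, ‖F x‖ ^ 2 = ∫ x, ‖F x‖ ^ 2 :=
    setIntegral_eq_integral_of_forall_compl_eq_zero fun x hx => by simp [hF0 x hx]
  rw [← e1, ← e2]
  simpa [Real.sqrt_eq_rpow] using cs

/-- `f` is smooth with topological support contained in `S`. -/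
def SmoothSupportedIn (S : Set ℂ) (f : ℂ → ℂ) : Prop :=
  ContDiff ℝ (⊤ : ℕ∞) f ∧ tsupport f ⊆ S

namespace SmoothSupportedIn

variable {S : Set ℂ} {f g φ : ℂ → ℂ}

theorem contDiff (hf : SmoothSupportedIn S f) (n : ℕ) : ContDiff ℝ n f :=
  hf.1.of_le (by exact_mod_cast le_top)

theorem hasCompactSupport (hf : SmoothSupportedIn S f) (hS : IsCompact S) :
    HasCompactSupport f :=
  hS.of_isClosed_subset (isClosed_tsupport f) hf.2

theorem contDiff_two (hf : SmoothSupportedIn S f) : ContDiff ℝ 2 f := hf.contDiff 2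

theorem contDiff_one (hf : SmoothSupportedIn S f) : ContDiff ℝ 1 f := by
  simpa using hf.contDiff 1

theorem memLp (hf : SmoothSupportedIn S f) (hS : IsCompact S) : MemLp f 2 volume :=
  hf.1.continuous.memLp_of_hasCompactSupport (hf.hasCompactSupport hS)

theorem fderiv_apply (hf : SmoothSupportedIn S f) (v : ℂ) :
    SmoothSupportedIn S fun z => fderiv ℝ f z v :=
  ⟨contDiff_fderiv_apply_const (n := ⊤) (m := ⊤) hf.1 (by simp) v,
    (tsupport_fderiv_apply_subset ℝ v).trans hf.2⟩

theorem add (hf : SmoothSupportedIn S f) (hg : SmoothSupportedIn S g) :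
    SmoothSupportedIn S fun z => f z + g z :=
  ⟨hf.1.add hg.1, (tsupport_add f g).trans (union_subset hf.2 hg.2)⟩

theorem contDiff_dZ_cauchyTransform (hf : SmoothSupportedIn S f) (hS : IsCompact S) :
    ContDiff ℝ (⊤ : ℕ∞) (dZ (cauchyTransform f)) := by
  have h := contDiff_cauchyTransform hf.1 (hf.hasCompactSupport hS)
  have h' v := contDiff_fderiv_apply_const (n := ⊤) (m := ⊤) h (by simp) v
  rw [dZ_eq]
  exact (contDiff_const.mul (h' 1)).add (contDiff_const.mul (h' I))

theorem mul_dZ_cauchyTransform (hφ : SmoothSupportedIn S φ) (hf : SmoothSupportedIn S f)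
    (hS : IsCompact S) : SmoothSupportedIn S fun z => φ z * dZ (cauchyTransform f) z :=
  ⟨hφ.1.mul (hf.contDiff_dZ_cauchyTransform hS), (tsupport_mul_subset_left).trans hφ.2⟩

theorem dZ (hf : SmoothSupportedIn S f) : SmoothSupportedIn S (dZ f) := by
  have h v := (hf.fderiv_apply v)
  rw [dZ_eq]
  refine ⟨(contDiff_const.mul (h 1).1).add (contDiff_const.mul (h I).1), ?_⟩
  exact (tsupport_add _ _).trans (union_subset
    ((tsupport_mul_subset_right).trans (h 1).2) ((tsupport_mul_subset_right).trans (h I).2))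

theorem fderiv_dZ_cauchyTransform (hf : SmoothSupportedIn S f) (hS : IsCompact S) (z v : ℂ) :
    fderiv ℝ (_root_.dZ (cauchyTransform f)) z v =
      _root_.dZ (cauchyTransform fun w => fderiv ℝ f w v) z := by
  have hc := hf.hasCompactSupport hS
  have hT : ContDiff ℝ 2 (cauchyTransform f) := contDiff_cauchyTransform (n := 2) hf.contDiff_two hc
  have e : (cauchyTransform fun w => fderiv ℝ f w v) =
      fun z => fderiv ℝ (cauchyTransform f) z v := by
    ext z; rw [fderiv_cauchyTransform hf.contDiff_one hc]
  have hd (w : ℂ) : DifferentiableAt ℝ (fun z => fderiv ℝ (cauchyTransform f) z w) z :=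
    (contDiff_fderiv_apply_const (n := 2) (m := 1) hT (by norm_num) w).differentiable
      one_ne_zero z
  rw [e, dZ_eq, dZ_eq, fderiv_fun_add ((hd 1).const_mul _) ((hd I).const_mul _),
    fderiv_const_mul (hd 1), fderiv_const_mul (hd I)]
  simp [fderiv_fderiv_apply_comm hT z v]

theorem fderiv_mul_dZ_cauchyTransform (hφ : SmoothSupportedIn S φ) (hf : SmoothSupportedIn S f)
    (hS : IsCompact S) (z v : ℂ) :
    fderiv ℝ (fun z => φ z * _root_.dZ (cauchyTransform f) z) z v =
      fderiv ℝ φ z v * _root_.dZ (cauchyTransform f) z +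
        φ z * _root_.dZ (cauchyTransform fun w => fderiv ℝ f w v) z := by
  rw [fderiv_fun_mul (hφ.contDiff_one.differentiable one_ne_zero z)
    ((hf.contDiff_dZ_cauchyTransform hS).differentiable (by simp) z)]
  simp [hf.fderiv_dZ_cauchyTransform hS]
  ring

theorem exists_norm_le (hf : SmoothSupportedIn S f) (hS : IsCompact S) : ∃ M, ∀ z, ‖f z‖ ≤ M :=
  (hf.hasCompactSupport hS).exists_bound_of_continuous hf.1.continuous

end SmoothSupportedIn

/-- The `L²` norms of all derivatives of order at most `m` are summable along the sequence `e`. -/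
def SobolevSummable : ℕ → (ℕ → ℂ → ℂ) → Prop
  | 0, e => Summable fun n => lpNorm (e n) 2 volume
  | m + 1, e => (Summable fun n => lpNorm (e n) 2 volume) ∧
      ∀ v, SobolevSummable m fun n z => fderiv ℝ (e n) z v

namespace SobolevSummable

variable {S : Set ℂ} {e h : ℕ → ℂ → ℂ} {φ : ℂ → ℂ} {m : ℕ}

theorem summable_lpNorm (he : SobolevSummable m e) : Summable fun n => lpNorm (e n) 2 volume := by
  cases m with
  | zero => exact he
  | succ m => exact he.1

theorem of_succ (he : SobolevSummable (m + 1) e) : SobolevSummable m e := by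
  induction m generalizing e with
  | zero => exact he.1
  | succ m ih => exact ⟨he.1, fun v => ih (he.2 v)⟩

theorem zero : SobolevSummable m fun _ _ => 0 := by
  induction m with
  | zero => simp [SobolevSummable, summable_zero]
  | succ m ih => exact ⟨by simp [summable_zero], fun v => by simpa using ih⟩

theorem add (hS : IsCompact S) (hes : ∀ n, SmoothSupportedIn S (e n))
    (hhs : ∀ n, SmoothSupportedIn S (h n)) (he : SobolevSummable m e)
    (hh : SobolevSummable m h) : SobolevSummable m fun n z => e n z + h n z := by
  have key : Summable fun n => lpNorm (fun z => e n z + h n z) 2 volume :=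
    Summable.of_nonneg_of_le (fun _ => lpNorm_nonneg)
      (fun n => lpNorm_add_le ((hes n).memLp hS) (by norm_num))
      (he.summable_lpNorm.add hh.summable_lpNorm)
  induction m generalizing e h with
  | zero => exact key
  | succ m ih =>
    refine ⟨key, fun v => ?_⟩
    have e1 : (fun n z => fderiv ℝ (fun z => e n z + h n z) z v) =
        fun n z => fderiv ℝ (e n) z v + fderiv ℝ (h n) z v := by
      ext n z
      rw [fderiv_fun_add ((hes n).contDiff_one.differentiable one_ne_zero z)
        ((hhs n).contDiff_one.differentiable one_ne_zero z)]
      rfl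
    rw [e1]
    exact ih (fun n => (hes n).fderiv_apply v) (fun n => (hhs n).fderiv_apply v) (he.2 v) (hh.2 v)
      (Summable.of_nonneg_of_le (fun _ => lpNorm_nonneg)
      (fun n => lpNorm_add_le (((hes n).fderiv_apply v).memLp hS) (by norm_num))
      ((he.2 v).summable_lpNorm.add (hh.2 v).summable_lpNorm))

theorem mul_dZ_cauchyTransform (hS : IsCompact S) (hφ : SmoothSupportedIn S φ)
    (hes : ∀ n, SmoothSupportedIn S (e n)) (he : SobolevSummable m e) :
    SobolevSummable m fun n z => φ z * dZ (cauchyTransform (e n)) z := by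
  induction m generalizing e φ with
  | zero =>
    obtain ⟨M, hM⟩ := hφ.exists_norm_le hS
    exact Summable.of_nonneg_of_le (fun _ => lpNorm_nonneg)
      (fun n => lpNorm_mul_dZ_cauchyTransform_le (hes n).contDiff_two
        ((hes n).hasCompactSupport hS) hφ.1.continuous hM) (he.mul_left M)
  | succ m ih =>
    refine ⟨(ih hφ hes he.of_succ).summable_lpNorm, fun v => ?_⟩
    simp only [fun n z => hφ.fderiv_mul_dZ_cauchyTransform (hes n) hS z v]
    exact add hS (fun n => (hφ.fderiv_apply v).mul_dZ_cauchyTransform (hes n) hS)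
      (fun n => hφ.mul_dZ_cauchyTransform ((hes n).fderiv_apply v) hS)
      (ih (hφ.fderiv_apply v) hes he.of_succ) (ih hφ (fun n => (hes n).fderiv_apply v) (he.2 v))

end SobolevSummable

theorem summable_of_succ_le_mul_add {a b : ℕ → ℝ} {k : ℝ} (ha : ∀ n, 0 ≤ a n)
    (hk : k < 1) (hb0 : ∀ n, 0 ≤ b n) (hb : Summable b) (h : ∀ n, a (n + 1) ≤ k * a n + b n) :
    Summable a := by
  refine summable_of_sum_range_le (c := (a 0 + ∑' n, b n) / (1 - k)) ha fun N => ?_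
  rw [le_div_iff₀ (by linarith)]
  have h1 : ∑ i ∈ Finset.range (N + 1), a i ≤
      k * ∑ i ∈ Finset.range N, a i + ∑ i ∈ Finset.range N, b i + a 0 := by
    rw [Finset.sum_range_succ', Finset.mul_sum, ← Finset.sum_add_distrib]
    gcongr with i
    exact h i
  have h2 : ∑ i ∈ Finset.range N, b i ≤ ∑' n, b n := hb.sum_le_tsum _ fun i _ => hb0 i
  rw [Finset.sum_range_succ] at h1
  linarith [ha N]

theorem SobolevSummable.of_recursion {S : Set ℂ} {e h : ℕ → ℂ → ℂ} {μ : ℂ → ℂ} {k : ℝ} {m : ℕ}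
    (hS : IsCompact S) (hμ : SmoothSupportedIn S μ) (hk : k < 1) (hμk : ∀ z, ‖μ z‖ ≤ k)
    (hes : ∀ n, SmoothSupportedIn S (e n)) (hhs : ∀ n, SmoothSupportedIn S (h n))
    (hh : SobolevSummable m h)
    (hrec : ∀ n z, e (n + 1) z = μ z * dZ (cauchyTransform (e n)) z + h n z) :
    SobolevSummable m e := by
  induction m generalizing e h with
  | zero =>
    refine summable_of_succ_le_mul_add (fun _ => lpNorm_nonneg) hk
      (fun _ => lpNorm_nonneg) hh fun n => ?_
    have e1 : e (n + 1) = (fun z => μ z * dZ (cauchyTransform (e n)) z) + h n :=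
      funext (hrec n)
    rw [e1]
    refine (lpNorm_add_le ((hμ.mul_dZ_cauchyTransform (hes n) hS).memLp hS) (by norm_num)).trans ?_
    gcongr
    exact lpNorm_mul_dZ_cauchyTransform_le (hes n).contDiff_two ((hes n).hasCompactSupport hS)
      hμ.1.continuous hμk
  | succ m ih =>
    have hm : SobolevSummable m e := ih hes hhs hh.of_succ hrec
    refine ⟨hm.summable_lpNorm, fun v => ?_⟩
    refine ih (h := fun n z => fderiv ℝ μ z v * dZ (cauchyTransform (e n)) z + fderiv ℝ (h n) z v)
      (fun n => (hes n).fderiv_apply v)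
      (fun n => ((hμ.fderiv_apply v).mul_dZ_cauchyTransform (hes n) hS).add
        ((hhs n).fderiv_apply v))
      (SobolevSummable.add hS (fun n => (hμ.fderiv_apply v).mul_dZ_cauchyTransform (hes n) hS)
        (fun n => (hhs n).fderiv_apply v)
        (hm.mul_dZ_cauchyTransform hS (hμ.fderiv_apply v) hes) (hh.2 v)) fun n z => ?_
    rw [funext (hrec n), fderiv_fun_add
      ((hμ.mul_dZ_cauchyTransform (hes n) hS).contDiff_one.differentiable one_ne_zero z)
      ((hhs n).contDiff_one.differentiable one_ne_zero z), add_apply,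
      hμ.fderiv_mul_dZ_cauchyTransform (hes n) hS]
    ring

theorem norm_le_norm_apply_one_add_norm_apply_I (L : ℂ →L[ℝ] ℂ) : ‖L‖ ≤ ‖L 1‖ + ‖L I‖ := by
  refine L.opNorm_le_bound (by positivity) fun v => ?_
  have e : L v = (v.re : ℂ) * L 1 + (v.im : ℂ) * L I := by
    conv_lhs => rw [← Complex.re_add_im v]
    have h1 : ((v.re : ℂ) + v.im * I) = v.re • (1 : ℂ) + v.im • I := by simp
    rw [h1, map_add, map_smul, map_smul]
    simp
  rw [e]
  refine (norm_add_le _ _).trans ?_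
  simp only [norm_mul, Complex.norm_real, Real.norm_eq_abs]
  have := Complex.abs_re_le_norm v
  have := Complex.abs_im_le_norm v
  nlinarith [norm_nonneg (L 1), norm_nonneg (L I)]

theorem exists_norm_cauchyTransform_le_lpNorm {S : Set ℂ} (hS : IsCompact S) :
    ∃ K, 0 ≤ K ∧ ∀ g : ℂ → ℂ, SmoothSupportedIn S g → ∀ z, ‖cauchyTransform g z‖ ≤
      K * lpNorm (fun x => fderiv ℝ (fun y => fderiv ℝ g y 1) x I) 2 volume := by
  obtain ⟨C, hC, hg⟩ := exists_norm_le_lpNorm_fderiv_fderiv hS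
  obtain ⟨R, hR⟩ := hS.isBounded.subset_ball 0
  obtain ⟨C', hC', hg'⟩ := exists_norm_cauchyTransform_le R
  refine ⟨C' * C, by positivity, fun g h z => ?_⟩
  rw [mul_assoc]
  refine hg' g _ (fun w hw => image_eq_zero_of_notMem_tsupport fun hw' => ?_)
    (hg g h.contDiff_two h.2) z
  have := hR (h.2 hw')
  simp at this
  linarith

/-- The Neumann series for the logarithm of `∂_z Φ`. -/
noncomputable def beltramiTerm (μ : ℂ → ℂ) : ℕ → ℂ → ℂ
  | 0 => dZ μ
  | n + 1 => fun z => μ z * dZ (cauchyTransform (beltramiTerm μ n)) z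

theorem exists_log_derivative_solution {μ : ℂ → ℂ} {k : ℝ} (hμsmooth : ContDiff ℝ (⊤ : ℕ∞) μ)
    (hμsupp : HasCompactSupport μ) (hk : k < 1) (hμk : ∀ z : ℂ, ‖μ z‖ ≤ k) :
    ∃ σ : ℂ → ℂ, ContDiff ℝ 1 σ ∧ (∃ M, ∀ z, ‖σ z‖ ≤ M) ∧
      ∀ z, dZbar σ z = μ z * dZ σ z + dZ μ z := by
  set S := tsupport μ with hSdef
  have hS : IsCompact S := hμsupp
  have hμ : SmoothSupportedIn S μ := ⟨hμsmooth, subset_rfl⟩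
  set d := beltramiTerm μ with hd
  have hds : ∀ n, SmoothSupportedIn S (d n) := fun n => by
    induction n with
    | zero => exact hμ.dZ
    | succ n ih => exact hμ.mul_dZ_cauchyTransform ih hS
  have hsum : SobolevSummable 3 d := SobolevSummable.of_recursion hS hμ hk hμk hds
    (h := fun _ _ => 0) (fun _ => ⟨contDiff_const, by simp [tsupport]⟩) SobolevSummable.zero
    fun n z => by rw [add_zero]; rfl
  obtain ⟨K, hK, hKb⟩ := exists_norm_cauchyTransform_le_lpNorm hS
  set s : ℕ → ℂ → ℂ := fun n => cauchyTransform (d n) with hs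
  have hs1 : ∀ n, ContDiff ℝ 1 (s n) := fun n =>
    contDiff_cauchyTransform (n := 1) (hds n).contDiff_one ((hds n).hasCompactSupport hS)
  set u : ℕ → ℝ := fun n =>
    K * lpNorm (fun x => fderiv ℝ (fun y => fderiv ℝ (d n) y 1) x I) 2 volume with hu
  set w : ℂ → ℕ → ℝ := fun v n => K * lpNorm (fun x => fderiv ℝ (fun y =>
    fderiv ℝ (fun y => fderiv ℝ (d n) y v) y 1) x I) 2 volume with hw
  have su : Summable u := ((hsum.of_succ.2 1).2 I).summable_lpNorm.mul_left K
  have sw v : Summable (w v) := (((hsum.2 v).2 1).2 I).summable_lpNorm.mul_left K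
  have bu n z : ‖s n z‖ ≤ u n := hKb _ (hds n) z
  have bw n z v : ‖fderiv ℝ (s n) z v‖ ≤ w v n := by
    rw [hs, fderiv_cauchyTransform (hds n).contDiff_one ((hds n).hasCompactSupport hS)]
    exact hKb _ ((hds n).fderiv_apply v) z
  have bw' n z : ‖fderiv ℝ (s n) z‖ ≤ w 1 n + w I n :=
    (norm_le_norm_apply_one_add_norm_apply_I _).trans (add_le_add (bw n z 1) (bw n z I))
  have sw' : Summable fun n => w 1 n + w I n := (sw 1).add (sw I)
  have ssum z : Summable fun n => s n z := Summable.of_norm_bounded su fun n => bu n z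
  have sfd z : Summable fun n => fderiv ℝ (s n) z := Summable.of_norm_bounded sw' fun n => bw' n z
  have hfd z : HasFDerivAt (fun y => ∑' n, s n y) (∑' n, fderiv ℝ (s n) z) z :=
    hasFDerivAt_tsum sw' (fun n x => ((hs1 n).differentiable one_ne_zero x).hasFDerivAt)
      bw' (ssum 0) z
  have hfda z v : fderiv ℝ (fun y => ∑' n, s n y) z v = ∑' n, fderiv ℝ (s n) z v := by
    rw [(hfd z).fderiv]
    exact (ContinuousLinearMap.apply ℝ ℂ v).map_tsum (sfd z)
  have sfa z v : Summable fun n => fderiv ℝ (s n) z v :=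
    (sfd z).map (ContinuousLinearMap.apply ℝ ℂ v) (ContinuousLinearMap.apply ℝ ℂ v).continuous
  have hdZ z : HasSum (fun n => dZ (s n) z) (dZ (fun y => ∑' n, s n y) z) := by
    simp only [dZ, hfda]
    exact ((sfa z 1).hasSum.sub ((sfa z I).hasSum.mul_left I)).div_const 2
  have hdZbar z : HasSum (fun n => d n z) (dZbar (fun y => ∑' n, s n y) z) := by
    have e n : d n z = dZbar (s n) z := by
      rw [hs, dZbar_cauchyTransform_eq_self (hds n).contDiff_one ((hds n).hasCompactSupport hS)]
    simp only [e]
    simp only [dZbar, hfda]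
    exact ((sfa z 1).hasSum.add ((sfa z I).hasSum.mul_left I)).div_const 2
  refine ⟨fun z => ∑' n, s n z, ?_, ⟨∑' n, u n, fun z =>
    tsum_of_norm_bounded su.hasSum fun n => bu n z⟩, fun z => ?_⟩
  · rw [contDiff_one_iff_fderiv]
    refine ⟨fun z => (hfd z).differentiableAt, ?_⟩
    rw [show fderiv ℝ (fun y => ∑' n, s n y) = fun z => ∑' n, fderiv ℝ (s n) z from
      funext fun z => (hfd z).fderiv]
    exact continuous_tsum (fun n => (hs1 n).continuous_fderiv one_ne_zero) sw' bw'
  · have h1 := (hasSum_nat_add_iff' 1).2 (hdZbar z)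
    have h2 := h1.unique ((hdZ z).mul_left (μ z))
    rw [Finset.sum_range_one] at h2
    rw [← h2]
    change _ = _ - dZ μ z + _
    ring

theorem IsLocalHomeomorph.isHomeomorph_of_tendsto_cocompact {f : ℂ → ℂ}
    (hf : IsLocalHomeomorph f) (h : Tendsto f (cocompact ℂ) (cocompact ℂ)) : IsHomeomorph f := by
  have hp : IsProperMap f := isProperMap_iff_tendsto_cocompact.2 ⟨hf.continuous, h⟩
  have hfin : ∀ x ∈ (univ : Set ℂ), (f ⁻¹' {x}).Finite := fun x _ =>
    (hp.isCompact_preimage isCompact_singleton).finite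
      (.of_openPartialHomeomorph f subset_rfl fun e _ => by
        obtain ⟨φ, h1, h2⟩ := hf e
        exact ⟨φ, h1, h2.symm⟩)
  have hcov : IsCoveringMap f := by
    rw [isCoveringMap_iff_isCoveringMapOn_univ]
    exact hp.isClosedMap.isCoveringMapOn_of_isLocalHomeomorphOn hfin hf.isLocalHomeomorphOn
  obtain ⟨F, ⟨hF0, hF⟩, -⟩ :=
    hcov.existsUnique_continuousMap_lifts (ContinuousMap.id ℂ) (f 0) 0 rfl
  have hF' : ∀ z, f (F z) = z := fun z => congrFun hF z
  have hl : F ∘ f = id := hcov.eq_of_comp_eq (F.continuous.comp hf.continuous) continuous_id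
    (funext fun z => hF' (f z)) 0 hF0
  exact ⟨hf.continuous, hf.isOpenMap, Function.LeftInverse.injective (g := F) (congrFun hl),
    Function.RightInverse.surjective (g := F) hF'⟩

theorem fderiv_eq_dZ_mul_add_dZbar_mul (f : ℂ → ℂ) (z v : ℂ) :
    fderiv ℝ f z v = dZ f z * v + dZbar f z * (starRingEnd ℂ) v := by
  have h1 : v = v.re • (1 : ℂ) + v.im • I := by simp
  conv_lhs => rw [h1]
  rw [map_add, map_smul, map_smul, dZ, dZbar, Complex.real_smul, Complex.real_smul]
  conv_rhs => rw [← Complex.re_add_im v]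
  simp only [map_add, map_mul, Complex.conj_ofReal, Complex.conj_I]
  ring_nf
  simp only [Complex.I_sq]
  ring

theorem dZ_eq_of_hasFDerivAt {f : ℂ → ℂ} {L : ℂ →L[ℝ] ℂ} {z a b : ℂ} (hf : HasFDerivAt f L z)
    (hL : ∀ v, L v = a * v + b * (starRingEnd ℂ) v) : dZ f z = a := by
  rw [dZ, hf.fderiv, hL, hL]
  simp only [map_one, Complex.conj_I]
  ring_nf
  simp only [Complex.I_sq]
  ring

theorem dZbar_eq_of_hasFDerivAt {f : ℂ → ℂ} {L : ℂ →L[ℝ] ℂ} {z a b : ℂ} (hf : HasFDerivAt f L z)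
    (hL : ∀ v, L v = a * v + b * (starRingEnd ℂ) v) : dZbar f z = b := by
  rw [dZbar, hf.fderiv, hL, hL]
  simp only [map_one, Complex.conj_I]
  ring_nf
  simp only [Complex.I_sq]
  ring

/-- The form `e^σ (dz + μ dz̄)`. -/
noncomputable def beltramiForm (σ μ : ℂ → ℂ) (z : ℂ) : ℂ →L[ℝ] ℂ :=
  cexp (σ z) • (ContinuousLinearMap.id ℝ ℂ + μ z • (conjCLE : ℂ →L[ℝ] ℂ))

theorem beltramiForm_apply (σ μ : ℂ → ℂ) (z v : ℂ) :
    beltramiForm σ μ z v = cexp (σ z) * v + μ z * cexp (σ z) * (starRingEnd ℂ) v := by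
  simp [beltramiForm]
  ring

theorem contDiff_beltramiForm {σ μ : ℂ → ℂ} (hσ : ContDiff ℝ 1 σ) (hμ : ContDiff ℝ 1 μ) :
    ContDiff ℝ 1 (beltramiForm σ μ) :=
  hσ.cexp.smul (contDiff_const.add (hμ.smul contDiff_const))

theorem exists_hasFDerivAt_beltramiForm {σ μ : ℂ → ℂ} (hσ : ContDiff ℝ 1 σ)
    (hμ : ContDiff ℝ 1 μ) (h : ∀ z, dZbar σ z = μ z * dZ σ z + dZ μ z) :
    ∃ Φ : ℂ → ℂ, ∀ z, HasFDerivAt Φ (beltramiForm σ μ z) z := by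
  have hd := (contDiff_beltramiForm hσ hμ).differentiable one_ne_zero
  have hform : ∀ z a b, fderiv ℝ (beltramiForm σ μ) z a b = cexp (σ z) *
      (fderiv ℝ σ z a * (b + μ z * (starRingEnd ℂ) b) + fderiv ℝ μ z a * (starRingEnd ℂ) b) := by
    intro z a b
    have hσd := (hσ.differentiable one_ne_zero z).hasFDerivAt
    have hμd := (hμ.differentiable one_ne_zero z).hasFDerivAt
    have e1 : HasFDerivAt (fun w => beltramiForm σ μ w b)
        ((fderiv ℝ (beltramiForm σ μ) z).flip b) z := by
      simpa using (hd z).hasFDerivAt.clm_apply (hasFDerivAt_const b z)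
    have e2 := (hσd.cexp.mul_const b).add ((hμd.mul hσd.cexp).mul_const ((starRingEnd ℂ) b))
    have e3 := congrArg (fun L => L a) (e1.unique
      (e2.congr_of_eventuallyEq (Eventually.of_forall fun w => beltramiForm_apply σ μ w b)))
    simp only [ContinuousLinearMap.flip_apply] at e3
    rw [e3]
    simp
    ring
  obtain ⟨Φ, hΦ⟩ := convex_univ.exists_forall_hasFDerivAt_of_fderiv_symmetric isOpen_univ
    hd.differentiableOn (fun z _ a b => by
      rw [hform, hform]
      simp only [fderiv_eq_dZ_mul_add_dZbar_mul, h]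
      ring)
  exact ⟨Φ, fun z => hΦ z (mem_univ z)⟩

theorem isLocalHomeomorph_of_contDiff {f : ℂ → ℂ} (hf : ContDiff ℝ 1 f)
    (h : ∀ z, Function.Injective (fderiv ℝ f z)) : IsLocalHomeomorph f := fun z => by
  let e : ℂ ≃L[ℝ] ℂ :=
    (LinearEquiv.ofInjectiveEndo (fderiv ℝ f z : ℂ →ₗ[ℝ] ℂ) (h z)).toContinuousLinearEquiv
  have he : HasFDerivAt f (e : ℂ →L[ℝ] ℂ) z :=
    (hf.differentiable one_ne_zero z).hasFDerivAt
  exact ⟨hf.contDiffAt.toOpenPartialHomeomorph f he one_ne_zero,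
    hf.contDiffAt.mem_toOpenPartialHomeomorph_source he one_ne_zero, rfl⟩

theorem beltramiForm_injective {σ μ : ℂ → ℂ} {z : ℂ} (hμ : ‖μ z‖ < 1) :
    Function.Injective (beltramiForm σ μ z) := by
  rw [injective_iff_map_eq_zero]
  intro v hv
  rw [beltramiForm_apply] at hv
  have h1 : cexp (σ z) * (v + μ z * (starRingEnd ℂ) v) = 0 := by rw [← hv]; ring
  have h2 := (mul_eq_zero.1 h1).resolve_left (Complex.exp_ne_zero _)
  have h3 : ‖v‖ = ‖μ z‖ * ‖v‖ := by
    conv_lhs => rw [eq_neg_of_add_eq_zero_left h2, norm_neg, norm_mul, RCLike.norm_conj]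
  by_contra hv0
  have := norm_pos_iff.2 hv0
  nlinarith

theorem tendsto_cocompact_of_hasFDerivAt_beltramiForm {σ μ Φ : ℂ → ℂ} (hσ : ContDiff ℝ 1 σ)
    {M : ℝ} (hM : ∀ z, ‖σ z‖ ≤ M) (hμ : ContDiff ℝ 1 μ) (hc : HasCompactSupport μ)
    (hΦ : ∀ z, HasFDerivAt Φ (beltramiForm σ μ z) z) :
    Tendsto Φ (cocompact ℂ) (cocompact ℂ) := by
  set h : ℂ → ℂ := fun z => μ z * cexp (σ z) with hh
  have hh1 : ContDiff ℝ 1 h := hμ.mul hσ.cexp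
  have hhc : HasCompactSupport h := hc.mul_right
  set G := cauchyTransform h with hG
  have hG1 : ContDiff ℝ 1 G := contDiff_cauchyTransform (n := 1) hh1 hhc
  have hGbar : dZbar G = h := dZbar_cauchyTransform_eq_self hh1 hhc
  have hdc : HasCompactSupport (dZ h) := by
    rw [dZ_eq]
    exact ((hhc.fderiv_apply ℝ 1).mul_left).add ((hhc.fderiv_apply ℝ I).mul_left)
  obtain ⟨C, hC, hdec⟩ := exists_cauchyTransform_decay (continuous_dZ hh1) hdc
  rw [← dZ_cauchyTransform hh1 hhc, ← hG] at hdec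
  obtain ⟨C', hC', hdec'⟩ := exists_cauchyTransform_decay hh1.continuous hhc
  set Ψ : ℂ → ℂ := fun z => Φ z - G z with hΨ
  have hderiv : ∀ z, HasDerivAt Ψ (cexp (σ z) - dZ G z) z := by
    intro z
    have h1 := (hΦ z).sub (hG1.differentiable one_ne_zero z).hasFDerivAt
    refine hasDerivAt_iff_hasFDerivAt.2 (hasFDerivAt_of_restrictScalars ℝ h1 ?_)
    refine ContinuousLinearMap.ext fun v => ?_
    rw [ContinuousLinearMap.coe_restrictScalars', sub_apply, beltramiForm_apply,
      fderiv_eq_dZ_mul_add_dZbar_mul, hGbar, ContinuousLinearMap.toSpanSingleton_apply, smul_eq_mul]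
    simp only [hh]
    ring
  have hΨd : Differentiable ℂ Ψ := fun z => (hderiv z).differentiableAt
  have hder : deriv Ψ = fun z => cexp (σ z) - dZ G z := funext fun z => (hderiv z).deriv
  have hexp : ∀ z, ‖cexp (σ z)‖ ≤ Real.exp M := fun z => by
    rw [Complex.norm_exp]
    exact Real.exp_le_exp.2 ((Complex.re_le_norm _).trans (hM z))
  have hexp' : ∀ z, Real.exp (-M) ≤ ‖cexp (σ z)‖ := fun z => by
    rw [Complex.norm_exp]
    exact Real.exp_le_exp.2 (by linarith [abs_le.1 (Complex.abs_re_le_norm (σ z)), hM z])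
  have hb : ∀ z, ‖dZ G z‖ ≤ C := fun z => (hdec z).trans
    (mul_le_of_le_one_right hC (inv_le_one_of_one_le₀ (by simp)))
  have hb' : ∀ z, ‖G z‖ ≤ C' := fun z => (hdec' z).trans
    (mul_le_of_le_one_right hC' (inv_le_one_of_one_le₀ (by simp)))
  obtain ⟨b, hbc⟩ := (hΨd.deriv).exists_const_forall_eq_of_bounded (by
    rw [hder, isBounded_iff_forall_norm_le]
    refine ⟨Real.exp M + C, ?_⟩
    rintro _ ⟨z, rfl⟩
    exact (norm_sub_le _ _).trans (add_le_add (hexp z) (hb z)))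
  have hb0 : b ≠ 0 := by
    rintro rfl
    set z : ℂ := ((C * Real.exp M : ℝ) : ℂ) with hz
    have hzn : ‖z‖ = C * Real.exp M := by
      rw [hz, Complex.norm_real, Real.norm_of_nonneg (by positivity)]
    have h1 : cexp (σ z) = dZ G z := sub_eq_zero.1 (by rw [← hbc z, hder])
    have h2 := (hexp' z).trans (h1 ▸ hdec z)
    rw [pow_one, hzn, Real.exp_neg, ← div_eq_mul_inv, le_div_iff₀ (by positivity),
      inv_mul_le_iff₀ (Real.exp_pos M)] at h2
    linarith
  have hlin : ∀ z, Φ z = b * z + Ψ 0 + G z := by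
    intro z
    have h1 : Ψ z - b * z = Ψ 0 - b * 0 := is_const_of_deriv_eq_zero (f := fun z => Ψ z - b * z)
      (hΨd.sub (differentiable_id.const_mul b)) (fun w => by
        rw [deriv_fun_sub (hΨd w) (by fun_prop), hbc]; simp) z 0
    have h2 : Ψ z = Φ z - G z := rfl
    linear_combination h1 - h2
  rw [← cobounded_eq_cocompact, ← tendsto_norm_atTop_iff_cobounded]
  refine tendsto_atTop_mono (f := fun z => ‖b‖ * ‖z‖ + -(‖Ψ 0‖ + C')) (fun z => ?_)
    (tendsto_atTop_add_const_right _ _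
      (tendsto_norm_cobounded_atTop.const_mul_atTop (norm_pos_iff.2 hb0)))
  have h1 : b * z = Φ z - (Ψ 0 + G z) := by rw [hlin]; ring
  have h2 := (norm_sub_le (Φ z) (Ψ 0 + G z)).trans
    (add_le_add_right ((norm_add_le _ _).trans (add_le_add_right (hb' z) _)) _)
  rw [← h1, norm_mul] at h2
  linarith

/-- **Theorem 2 (smooth case).** For `μ ∈ C_c^∞(ℂ)` with `‖μ‖_∞ = k < 1` there exists an
orientation-preserving homeomorphism `Φ : ℂ → ℂ` of class `C¹` solving the Beltrami
equation `∂_z̄ Φ = μ ∂_z Φ` everywhere, with everywhere positive Jacobian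
`J_Φ = |∂_z Φ|² - |∂_z̄ Φ|²`. -/
theorem beltrami_smooth_exists
    (μ : ℂ → ℂ) (k : ℝ) (hμsmooth : ContDiff ℝ (⊤ : ℕ∞) μ) (hμsupp : HasCompactSupport μ)
    (hk : k < 1) (hμk : ∀ z : ℂ, ‖μ z‖ ≤ k) :
    ∃ Φ : ℂ → ℂ, IsHomeomorph Φ ∧ ContDiff ℝ 1 Φ ∧
      (∀ z : ℂ, dZbar Φ z = μ z * dZ Φ z) ∧
      (∀ z : ℂ, 0 < ‖dZ Φ z‖ ^ 2 - ‖dZbar Φ z‖ ^ 2) := by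
  obtain ⟨σ, hσ, ⟨M, hM⟩, h⟩ := exists_log_derivative_solution hμsmooth hμsupp hk hμk
  have hμ1 : ContDiff ℝ 1 μ := hμsmooth.of_le (by simp)
  obtain ⟨Φ, hΦ⟩ := exists_hasFDerivAt_beltramiForm hσ hμ1 h
  have hfd : fderiv ℝ Φ = beltramiForm σ μ := funext fun z => (hΦ z).fderiv
  have hΦ1 : ContDiff ℝ 1 Φ := contDiff_one_iff_fderiv.2
    ⟨fun z => (hΦ z).differentiableAt, hfd ▸ (contDiff_beltramiForm hσ hμ1).continuous⟩
  have hμlt : ∀ z, ‖μ z‖ < 1 := fun z => (hμk z).trans_lt hk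
  have hdZ : ∀ z, dZ Φ z = cexp (σ z) := fun z =>
    dZ_eq_of_hasFDerivAt (hΦ z) (beltramiForm_apply σ μ z)
  have hdZbar : ∀ z, dZbar Φ z = μ z * cexp (σ z) := fun z =>
    dZbar_eq_of_hasFDerivAt (hΦ z) (beltramiForm_apply σ μ z)
  refine ⟨Φ, (isLocalHomeomorph_of_contDiff hΦ1 fun z => ?_).isHomeomorph_of_tendsto_cocompact
    (tendsto_cocompact_of_hasFDerivAt_beltramiForm hσ hM hμ1 hμsupp hΦ), hΦ1, fun z => ?_,
    fun z => ?_⟩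
  · rw [hfd]
    exact beltramiForm_injective (hμlt z)
  · rw [hdZ, hdZbar]
  · rw [hdZ, hdZbar, norm_mul, mul_pow]
    have h1 : 0 < ‖cexp (σ z)‖ := norm_pos_iff.2 (Complex.exp_ne_zero _)
    have h2 : ‖μ z‖ ^ 2 < 1 := by
      have := hμlt z
      have := norm_nonneg (μ z)
      nlinarith
    nlinarith [mul_pos (pow_pos h1 2) (sub_pos.2 h2)]
end

section
/- Let μ ∈ C_c^∞(ℂ) with ‖μ‖_∞ = k < 1, and let S(w,z) = 1/(π(w − z + μ(w)(w̄ − z̄))). Then there exist constants C₁, C₂ depending only on k such that for all w ≠ z (with derivatives taken in the z-variable, where S is smooth) |∂_z̄ S(w,z) − ∂_z(μ(z) S(w,z))| ≤ C₁ |μ(w) − μ(z)|/|w−z|² + C₂ |∂_z μ(z)|/|w−z|; consequently there is a constant C' depending only on μ such that |∂_z̄ S(w,z) − ∂_z(μ(z) S(w,z))| ≤ C'/|w−z| for all w ≠ z. -/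
open MeasureTheory Complex ENNReal NNReal Metric Set Filter

/-- The pseudo-fundamental solution `S(w,z) = 1/(π (w - z + μ(w)(w̄ - z̄)))` of the
Beltrami equation. -/
noncomputable def Sker (μ : ℂ → ℂ) (w z : ℂ) : ℂ :=
  1 / ((Real.pi : ℂ) * (w - z + μ w * ((starRingEnd ℂ) w - (starRingEnd ℂ) z)))

/-- The denominator of the kernel is comparable to `‖w - z‖` when `‖m‖ ≤ k`. -/
theorem le_norm_sub_add_mul_conj {k : ℝ} {m : ℂ} (hm : ‖m‖ ≤ k) (w z : ℂ) :
    (1 - k) * ‖w - z‖ ≤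
      ‖w - z + m * ((starRingEnd ℂ) w - (starRingEnd ℂ) z)‖ := by
  have h1 : ‖m * ((starRingEnd ℂ) w - (starRingEnd ℂ) z)‖ ≤ k * ‖w - z‖ := by
    rw [← map_sub, norm_mul, RCLike.norm_conj]
    gcongr
  have h2 := norm_sub_norm_le (w - z) (-(m * ((starRingEnd ℂ) w - (starRingEnd ℂ) z)))
  rw [sub_neg_eq_add, norm_neg] at h2
  linarith

/-- The real derivative of `z ↦ S(w,z)` off the zero set of the denominator. -/
theorem hasFDerivAt_Sker (μ : ℂ → ℂ) (w z : ℂ)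
    (hD : w - z + μ w * ((starRingEnd ℂ) w - (starRingEnd ℂ) z) ≠ 0) :
    HasFDerivAt (fun ζ => Sker μ w ζ)
      ((1 / ((Real.pi : ℂ) *
          (w - z + μ w * ((starRingEnd ℂ) w - (starRingEnd ℂ) z)) ^ 2)) •
        (ContinuousLinearMap.id ℝ ℂ + μ w • (conjCLE : ℂ →L[ℝ] ℂ))) z := by
  have hpi : (Real.pi : ℂ) ≠ 0 := by exact_mod_cast Real.pi_ne_zero
  have hden : HasFDerivAt
      (fun ζ : ℂ => (Real.pi : ℂ) *
        (w - ζ + μ w * ((starRingEnd ℂ) w - (starRingEnd ℂ) ζ)))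
      ((Real.pi : ℂ) • (-ContinuousLinearMap.id ℝ ℂ + μ w • -(conjCLE : ℂ →L[ℝ] ℂ))) z :=
    (((hasFDerivAt_id z).const_sub w).add
      ((conjCLE.hasFDerivAt.const_sub ((starRingEnd ℂ) w)).const_mul (μ w))).const_mul _
  have h := (hasDerivAt_inv (mul_ne_zero hpi hD)).comp_hasFDerivAt z hden
  refine (h.congr_fderiv ?_).congr_of_eventuallyEq (Eventually.of_forall fun ζ => ?_)
  · generalize w - z + μ w * ((starRingEnd ℂ) w - (starRingEnd ℂ) z) = D at hD
    apply ContinuousLinearMap.ext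
    intro v
    simp only [add_apply, smul_apply, neg_apply, ContinuousLinearMap.id_apply,
      ContinuousLinearEquiv.coe_coe, conjCLE_apply, smul_eq_mul]
    field_simp
    ring
  · exact one_div _

/-- The explicit formula for `∂_z̄ S(w,z) - ∂_z(μ(z) S(w,z))`. -/
theorem dZbar_Sker_sub_dZ_mul_Sker {μ : ℂ → ℂ} {w z : ℂ} (hμ : DifferentiableAt ℝ μ z)
    (hD : w - z + μ w * ((starRingEnd ℂ) w - (starRingEnd ℂ) z) ≠ 0) :
    dZbar (fun ζ => Sker μ w ζ) z - dZ (fun ζ => μ ζ * Sker μ w ζ) z =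
      (μ w - μ z) / ((Real.pi : ℂ) *
          (w - z + μ w * ((starRingEnd ℂ) w - (starRingEnd ℂ) z)) ^ 2) -
        dZ μ z / ((Real.pi : ℂ) *
          (w - z + μ w * ((starRingEnd ℂ) w - (starRingEnd ℂ) z))) := by
  have hpi : (Real.pi : ℂ) ≠ 0 := by exact_mod_cast Real.pi_ne_zero
  have hS := hasFDerivAt_Sker μ w z hD
  have hmul := hμ.hasFDerivAt.fun_mul hS
  have hI : Complex.I ^ 2 = -1 := Complex.I_sq
  unfold dZbar dZ
  rw [hS.fderiv, hmul.fderiv]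
  simp only [Sker, add_apply, smul_apply,
    ContinuousLinearMap.id_apply, ContinuousLinearEquiv.coe_coe, conjCLE_apply, map_one,
    conj_I, smul_eq_mul]
  generalize w - z + μ w * ((starRingEnd ℂ) w - (starRingEnd ℂ) z) = D at hD
  field_simp
  ring_nf
  simp only [hI]
  ring

/-- `‖∂_z f‖` is bounded by any Lipschitz constant of `f`. -/
theorem norm_dZ_le_of_lipschitzWith {f : ℂ → ℂ} {L : ℝ≥0} (hf : LipschitzWith L f) (z : ℂ) :
    ‖dZ f z‖ ≤ L := by
  have hL : ‖fderiv ℝ f z‖ ≤ L := norm_fderiv_le_of_lipschitz ℝ hf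
  have h1 : ‖fderiv ℝ f z 1‖ ≤ L :=
    ((fderiv ℝ f z).le_opNorm 1).trans (by simpa using hL)
  have h2 : ‖fderiv ℝ f z Complex.I‖ ≤ L :=
    ((fderiv ℝ f z).le_opNorm Complex.I).trans (by simpa using hL)
  have h3 := norm_sub_le (fderiv ℝ f z 1) (Complex.I * fderiv ℝ f z Complex.I)
  rw [norm_mul, norm_I, one_mul] at h3
  rw [dZ, norm_div, Complex.norm_ofNat]
  linarith

/-- **Bound on `∂_z̄^{μ*} S`** (Section 4.2, equation (12)).  For `μ ∈ C_c^∞(ℂ)` with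
`‖μ‖_∞ = k < 1`, there are constants `C₁, C₂ > 0` depending only on `k` such that for
`w ≠ z` (derivatives in the `z`-variable)
`|∂_z̄ S(w,z) - ∂_z(μ(z) S(w,z))| ≤ C₁|μ(w)-μ(z)|/|w-z|² + C₂|∂_z μ(z)|/|w-z|`;
consequently there is `C' > 0` depending only on `μ` with
`|∂_z̄ S(w,z) - ∂_z(μ(z) S(w,z))| ≤ C'/|w-z|`. -/
theorem sker_adjoint_bound (k : ℝ) (hk0 : 0 ≤ k) (hk : k < 1) :
    ∃ C₁ C₂ : ℝ, 0 < C₁ ∧ 0 < C₂ ∧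
      ∀ μ : ℂ → ℂ, ContDiff ℝ (⊤ : ℕ∞) μ → HasCompactSupport μ → (∀ z : ℂ, ‖μ z‖ ≤ k) →
        (∀ w z : ℂ, w ≠ z →
          ‖dZbar (fun ζ => Sker μ w ζ) z - dZ (fun ζ => μ ζ * Sker μ w ζ) z‖ ≤
            C₁ * ‖μ w - μ z‖ / ‖w - z‖ ^ 2 + C₂ * ‖dZ μ z‖ / ‖w - z‖) ∧
        ∃ C' : ℝ, 0 < C' ∧ ∀ w z : ℂ, w ≠ z →
          ‖dZbar (fun ζ => Sker μ w ζ) z - dZ (fun ζ => μ ζ * Sker μ w ζ) z‖ ≤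
            C' / ‖w - z‖ := by
  have hk1 : 0 < 1 - k := by linarith
  refine ⟨1 / (1 - k) ^ 2, 1 / (1 - k), by positivity, by positivity, ?_⟩
  intro μ hμ hsupp hbd
  have key : ∀ w z : ℂ, w ≠ z →
      ‖dZbar (fun ζ => Sker μ w ζ) z - dZ (fun ζ => μ ζ * Sker μ w ζ) z‖ ≤
        1 / (1 - k) ^ 2 * ‖μ w - μ z‖ / ‖w - z‖ ^ 2 + 1 / (1 - k) * ‖dZ μ z‖ / ‖w - z‖ := by
    intro w z hwz
    have hr : 0 < ‖w - z‖ := norm_pos_iff.2 (sub_ne_zero.2 hwz)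
    have hle := le_norm_sub_add_mul_conj (hbd w) w z
    have hpos : 0 < (1 - k) * ‖w - z‖ := by positivity
    have hD := norm_pos_iff.1 (hpos.trans_le hle)
    have hpi : 1 ≤ Real.pi := by linarith [Real.pi_gt_three]
    rw [dZbar_Sker_sub_dZ_mul_Sker (hμ.differentiable (by simp) z) hD]
    generalize w - z + μ w * ((starRingEnd ℂ) w - (starRingEnd ℂ) z) = D at hle
    refine (norm_sub_le _ _).trans (add_le_add ?_ ?_)
    · rw [norm_div, norm_mul, norm_pow, norm_real, Real.norm_of_nonneg Real.pi_pos.le]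
      calc ‖μ w - μ z‖ / (Real.pi * ‖D‖ ^ 2)
          ≤ ‖μ w - μ z‖ / (1 * ((1 - k) * ‖w - z‖) ^ 2) := by gcongr
        _ = 1 / (1 - k) ^ 2 * ‖μ w - μ z‖ / ‖w - z‖ ^ 2 := by field_simp
    · rw [norm_div, norm_mul, norm_real, Real.norm_of_nonneg Real.pi_pos.le]
      calc ‖dZ μ z‖ / (Real.pi * ‖D‖)
          ≤ ‖dZ μ z‖ / (1 * ((1 - k) * ‖w - z‖)) := by gcongr
        _ = 1 / (1 - k) * ‖dZ μ z‖ / ‖w - z‖ := by field_simp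
  refine ⟨key, ?_⟩
  obtain ⟨L, hL⟩ := hμ.lipschitzWith_of_hasCompactSupport hsupp (by simp)
  refine ⟨1 / (1 - k) ^ 2 * L + 1 / (1 - k) * L + 1, by positivity, fun w z hwz => ?_⟩
  have hr : 0 < ‖w - z‖ := norm_pos_iff.2 (sub_ne_zero.2 hwz)
  calc _ ≤ _ := key w z hwz
    _ ≤ 1 / (1 - k) ^ 2 * (L * ‖w - z‖) / ‖w - z‖ ^ 2 + 1 / (1 - k) * L / ‖w - z‖ := by
      gcongr
      · exact hL.norm_sub_le w z
      · exact norm_dZ_le_of_lipschitzWith hL z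
    _ = (1 / (1 - k) ^ 2 * L + 1 / (1 - k) * L) / ‖w - z‖ := by field_simp
    _ ≤ _ := by
      exact div_le_div_of_nonneg_right (le_add_of_nonneg_right zero_le_one) hr.le
end

section
/- Let c ∈ ℂ with |c| < 1, let D ⊂ ℂ be an open disk, let φ ∈ C_c^∞(D), and let w ∈ D. Then (1/π) ∫_D (∂_z̄ φ(z) − c ∂_z φ(z)) / (w − z + c(w̄ − z̄)) dA(z) = φ(w). (This is the Cauchy–Green formula in the coordinates ζ = z + c z̄.) -/
open MeasureTheory Complex ENNReal NNReal Metric Set Filter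

/-- Integrability on a polar strip of a continuous function vanishing for large radius. -/
lemma integrableOn_polar_strip {F : ℝ × ℝ → ℂ} (hF : Continuous F) {R : ℝ}
    (hR : ∀ p : ℝ × ℝ, R < p.1 → F p = 0) :
    IntegrableOn F (Ioi (0 : ℝ) ×ˢ Ioo (-Real.pi) Real.pi) := by
  have hK : IntegrableOn F (Icc 0 R ×ˢ Icc (-Real.pi) Real.pi) :=
    hF.continuousOn.integrableOn_compact (isCompact_Icc.prod isCompact_Icc)
  refine hK.of_forall_sdiff_eq_zero (measurableSet_Ioi.prod measurableSet_Ioo) ?_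
  rintro ⟨ρ, θ⟩ ⟨⟨hρ, hθ⟩, hn⟩
  refine hR _ (not_le.1 fun hle => hn ?_)
  exact ⟨⟨le_of_lt hρ, hle⟩, Ioo_subset_Icc_self hθ⟩

lemma one_add_mul_sq_ne_zero {c v : ℂ} (hc : ‖c‖ < 1) (hv : ‖v‖ ≤ 1) : 1 + c * v ^ 2 ≠ 0 := by
  intro h
  have h1 : c * v ^ 2 = -1 := by linear_combination h
  have h2 : ‖c‖ * ‖v‖ ^ 2 = 1 := by
    rw [← norm_pow, ← norm_mul, h1, norm_neg, norm_one]
  have h3 : ‖v‖ ^ 2 ≤ 1 := pow_le_one₀ (norm_nonneg v) hv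
  nlinarith [norm_nonneg c]

lemma exp_mul_I_add_mul_exp_neg_ne_zero {c : ℂ} (hc : ‖c‖ < 1) (θ : ℝ) :
    exp (θ * I) + c * exp (-θ * I) ≠ 0 := by
  have hv : ‖exp (-θ * I)‖ ≤ 1 := by
    have := norm_exp_ofReal_mul_I (-θ)
    push_cast at this
    exact this.le
  have h := mul_ne_zero (exp_ne_zero (θ * I)) (one_add_mul_sq_ne_zero hc hv)
  have he : exp (θ * I) * exp (-θ * I) = 1 := by
    rw [← exp_add]; simp
  convert h using 1
  linear_combination (-c * exp (-θ * I)) * he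

/-- Mean value property for the logarithmic derivative of `θ ↦ e^{iθ} + c e^{-iθ}`. -/
lemma integral_skewed_ratio {c : ℂ} (hc : ‖c‖ < 1) :
    ∫ θ in (-Real.pi)..Real.pi,
      (exp (θ * I) - c * exp (-θ * I)) / (exp (θ * I) + c * exp (-θ * I)) = 2 * Real.pi := by
  set f : ℂ → ℂ := fun v => (1 - c * v ^ 2) / (1 + c * v ^ 2) with hf
  have hd : DiffContOnCl ℂ f (ball 0 |1|) := by
    apply DifferentiableOn.diffContOnCl
    intro v hv
    have hv' : ‖v‖ ≤ 1 := by
      simpa using closure_ball_subset_closedBall hv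
    exact DifferentiableAt.differentiableWithinAt
      (DifferentiableAt.div (by fun_prop) (by fun_prop) (one_add_mul_sq_ne_zero hc hv'))
  have hm := hd.circleAverage
  have hf0 : f 0 = 1 := by simp [hf]
  rw [hf0, Real.circleAverage_def] at hm
  have hper : Function.Periodic (fun θ : ℝ => f (circleMap 0 1 θ)) (2 * Real.pi) := fun θ => by
    simp only [periodic_circleMap 0 1 θ]
  have hint : ∫ θ in (-Real.pi)..Real.pi, f (circleMap 0 1 θ) = 2 * Real.pi := by
    have h1 := hper.intervalIntegral_add_eq (-Real.pi) 0
    rw [show -Real.pi + 2 * Real.pi = Real.pi by ring, zero_add] at h1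
    rw [h1]
    have hpi : (Real.pi : ℂ) ≠ 0 := by exact_mod_cast Real.pi_ne_zero
    rw [Complex.real_smul] at hm
    push_cast at hm
    field_simp at hm
    linear_combination hm
  have hneg := intervalIntegral.integral_comp_neg (a := -Real.pi) (b := Real.pi)
    (fun θ : ℝ => f (circleMap 0 1 θ))
  rw [neg_neg, hint] at hneg
  rw [← hneg]
  refine intervalIntegral.integral_congr fun θ _ => ?_
  have he : exp (θ * I) * exp (-θ * I) = 1 := by
    rw [← exp_add]; simp
  have h0 := exp_mul_I_add_mul_exp_neg_ne_zero hc θ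
  have hv : ‖exp (-θ * I)‖ ≤ 1 := by
    have := norm_exp_ofReal_mul_I (-θ)
    push_cast at this
    exact this.le
  have h1 := one_add_mul_sq_ne_zero hc hv
  simp only [hf, circleMap, ofReal_neg, Complex.ofReal_one, one_mul, zero_add]
  rw [div_eq_div_iff h0 h1]
  linear_combination (2 * c * exp (-θ * I)) * he

lemma dZbar_sub_mul_dZ_polar (c : ℂ) (φ : ℂ → ℂ) (z : ℂ) (θ : ℝ) :
    dZbar φ z - c * dZ φ z =
      ((exp (θ * I) - c * exp (-θ * I)) * fderiv ℝ φ z (exp (θ * I)) +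
        I * (exp (θ * I) + c * exp (-θ * I)) * fderiv ℝ φ z (I * exp (θ * I))) / 2 := by
  have hu : exp (θ * I) = Real.cos θ + Real.sin θ * I := by
    rw [exp_mul_I]; simp
  have hu' : exp (-θ * I) = Real.cos θ - Real.sin θ * I := by
    rw [exp_mul_I]; simp [sub_eq_add_neg]
  have h1 : fderiv ℝ φ z (exp (θ * I)) =
      Real.cos θ * fderiv ℝ φ z 1 + Real.sin θ * fderiv ℝ φ z I := by
    rw [hu, show (Real.cos θ + Real.sin θ * I : ℂ) =
      Real.cos θ • (1 : ℂ) + Real.sin θ • I by simp, map_add, map_smul, map_smul]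
    simp
  have h2 : fderiv ℝ φ z (I * exp (θ * I)) =
      -Real.sin θ * fderiv ℝ φ z 1 + Real.cos θ * fderiv ℝ φ z I := by
    rw [hu, show (I * (Real.cos θ + Real.sin θ * I) : ℂ) =
      (-Real.sin θ) • (1 : ℂ) + Real.cos θ • I by
        simp only [real_smul, ofReal_neg]
        linear_combination (Real.sin θ : ℂ) * I_sq, map_add, map_smul, map_smul]
    simp
  have hcs : (Real.cos θ : ℂ) ^ 2 + (Real.sin θ : ℂ) ^ 2 = 1 := by
    exact_mod_cast Real.cos_sq_add_sin_sq θ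
  rw [h1, h2, hu, hu', dZ, dZbar]
  generalize (Real.cos θ : ℂ) = x at *
  generalize (Real.sin θ : ℂ) = y at *
  generalize fderiv ℝ φ z 1 = a
  generalize fderiv ℝ φ z I = b
  linear_combination (-(a + I * b - c * a + c * I * b) / 2) * hcs -
    (y * (x * b - y * a) * (1 - c) / 2) * I_sq

/-- The integrals of the radial and angular derivatives in polar coordinates about `w`. -/
lemma integral_polar_skewed {c : ℂ} (hc : ‖c‖ < 1) {φ : ℂ → ℂ}
    (hφ : ContDiff ℝ (⊤ : ℕ∞) φ) (hφc : HasCompactSupport φ) (w : ℂ) :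
    ∫ p in Ioi (0 : ℝ) ×ˢ Ioo (-Real.pi) Real.pi,
      ((exp (p.2 * I) - c * exp (-p.2 * I)) / (exp (p.2 * I) + c * exp (-p.2 * I)) *
          fderiv ℝ φ (w + p.1 * exp (p.2 * I)) (exp (p.2 * I)) +
        I * fderiv ℝ φ (w + p.1 * exp (p.2 * I)) (I * exp (p.2 * I))) =
      -(2 * Real.pi * φ w) := by
  have hdiff : Differentiable ℝ φ := hφ.differentiable (by simp)
  have hcd : Continuous (fderiv ℝ φ) := hφ.continuous_fderiv (by simp)
  obtain ⟨R₀, hR₀⟩ := hφc.isCompact.isBounded.subset_closedBall w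
  have hout : ∀ (ρ θ : ℝ), max R₀ 0 < ρ → w + ρ * exp (θ * I) ∉ tsupport φ := by
    intro ρ θ hρ hmem
    have h := hR₀ hmem
    rw [mem_closedBall, dist_eq_norm, add_sub_cancel_left, norm_mul, norm_exp_ofReal_mul_I,
      mul_one, norm_real, Real.norm_eq_abs] at h
    exact absurd ((le_abs_self ρ).trans h) (not_le.2 ((le_max_left _ _).trans_lt hρ))
  have hD0 : ∀ (ρ θ : ℝ), max R₀ 0 < ρ → fderiv ℝ φ (w + ρ * exp (θ * I)) = 0 := fun ρ θ hρ =>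
    image_eq_zero_of_notMem_tsupport fun h => hout ρ θ hρ (tsupport_fderiv_subset ℝ h)
  have hne : ∀ p : ℝ × ℝ, exp (p.2 * I) + c * exp (-p.2 * I) ≠ 0 := fun p =>
    exp_mul_I_add_mul_exp_neg_ne_zero hc p.2
  have hcA : Continuous fun p : ℝ × ℝ =>
      (exp (p.2 * I) - c * exp (-p.2 * I)) / (exp (p.2 * I) + c * exp (-p.2 * I)) *
          fderiv ℝ φ (w + p.1 * exp (p.2 * I)) (exp (p.2 * I)) := by
    refine (Continuous.div (by fun_prop) (by fun_prop) hne).mul ?_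
    exact (hcd.comp (by fun_prop)).clm_apply (by fun_prop)
  have hcB : Continuous fun p : ℝ × ℝ =>
      I * fderiv ℝ φ (w + p.1 * exp (p.2 * I)) (I * exp (p.2 * I)) := by
    exact continuous_const.mul ((hcd.comp (by fun_prop)).clm_apply (by fun_prop))
  have hiA := integrableOn_polar_strip hcA (R := max R₀ 0) fun p hp => by
    simp [hD0 p.1 p.2 hp]
  have hiB := integrableOn_polar_strip hcB (R := max R₀ 0) fun p hp => by
    simp [hD0 p.1 p.2 hp]
  rw [integral_add hiA hiB]
  have hline : ∀ (ρ θ : ℝ), HasDerivAt (fun s : ℝ => φ (w + s * exp (θ * I)))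
      (fderiv ℝ φ (w + ρ * exp (θ * I)) (exp (θ * I))) ρ := by
    intro ρ θ
    have hin : HasDerivAt (fun s : ℝ => w + s * exp (θ * I)) (exp (θ * I)) ρ := by
      simpa using ((hasDerivAt_id ρ).ofReal_comp.mul_const (exp (θ * I))).const_add w
    exact (hdiff _).hasFDerivAt.comp_hasDerivAt ρ hin
  have hcirc : ∀ (ρ θ : ℝ), HasDerivAt (fun s : ℝ => φ (w + ρ * exp (s * I)))
      (ρ * fderiv ℝ φ (w + ρ * exp (θ * I)) (I * exp (θ * I))) θ := by
    intro ρ θ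
    have hin : HasDerivAt (fun s : ℝ => w + ρ * exp (s * I)) (ρ • (I * exp (θ * I))) θ := by
      have h := ((((hasDerivAt_id θ).ofReal_comp.mul_const I).cexp).const_mul (ρ : ℂ)).const_add w
      refine h.congr_deriv ?_
      simp only [id, real_smul, Complex.ofReal_one]
      ring
    have := (hdiff _).hasFDerivAt.comp_hasDerivAt θ hin
    rwa [map_smul, real_smul] at this
  have hA : ∫ p in Ioi (0 : ℝ) ×ˢ Ioo (-Real.pi) Real.pi,
      (exp (p.2 * I) - c * exp (-p.2 * I)) / (exp (p.2 * I) + c * exp (-p.2 * I)) *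
          fderiv ℝ φ (w + p.1 * exp (p.2 * I)) (exp (p.2 * I)) = -(2 * Real.pi * φ w) := by
    have hrad : ∀ θ : ℝ,
        ∫ ρ in Ioi (0 : ℝ), fderiv ℝ φ (w + ρ * exp (θ * I)) (exp (θ * I)) = -φ w := by
      intro θ
      have hc' : Continuous fun ρ : ℝ => fderiv ℝ φ (w + ρ * exp (θ * I)) (exp (θ * I)) :=
        (hcd.comp (by fun_prop)).clm_apply continuous_const
      have hi : IntegrableOn
          (fun ρ : ℝ => fderiv ℝ φ (w + ρ * exp (θ * I)) (exp (θ * I))) (Ioi 0) := by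
        refine (hc'.continuousOn.integrableOn_compact
          (isCompact_Icc (a := 0) (b := max R₀ 0))).of_forall_sdiff_eq_zero measurableSet_Ioi ?_
        rintro ρ ⟨hρ, hn⟩
        rw [hD0 ρ θ (not_le.1 fun hle => hn ⟨le_of_lt hρ, hle⟩)]
        rfl
      have ht : Tendsto (fun ρ : ℝ => φ (w + ρ * exp (θ * I))) atTop (nhds 0) := by
        refine tendsto_const_nhds.congr' ?_
        filter_upwards [eventually_gt_atTop (max R₀ 0)] with ρ hρ
        exact (image_eq_zero_of_notMem_tsupport (hout ρ θ hρ)).symm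
      simpa using integral_Ioi_of_hasDerivAt_of_tendsto' (fun ρ _ => hline ρ θ) hi ht
    rw [Measure.volume_eq_prod, ← setIntegral_prod_swap]
    refine (setIntegral_prod _ hiA.swap).trans ?_
    simp only [Function.comp_apply, Prod.swap_prod_mk]
    simp_rw [integral_const_mul, hrad]
    rw [integral_mul_const, ← integral_Ioc_eq_integral_Ioo,
      ← intervalIntegral.integral_of_le (by linarith [Real.pi_pos]), integral_skewed_ratio hc]
    ring
  have hB : ∫ p in Ioi (0 : ℝ) ×ˢ Ioo (-Real.pi) Real.pi,
      I * fderiv ℝ φ (w + p.1 * exp (p.2 * I)) (I * exp (p.2 * I)) = 0 := by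
    rw [Measure.volume_eq_prod, setIntegral_prod _ hiB]
    refine setIntegral_eq_zero_of_forall_eq_zero fun ρ hρ => ?_
    have hρ' : (ρ : ℂ) ≠ 0 := by exact_mod_cast (ne_of_gt hρ)
    have hcc : Continuous fun θ : ℝ =>
        (ρ : ℂ) * fderiv ℝ φ (w + ρ * exp (θ * I)) (I * exp (θ * I)) :=
      continuous_const.mul ((hcd.comp (by fun_prop)).clm_apply (by fun_prop))
    have h := intervalIntegral.integral_eq_sub_of_hasDerivAt (a := -Real.pi) (b := Real.pi)
      (fun θ _ => hcirc ρ θ) (hcc.intervalIntegrable _ _)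
    have hends : exp ((-Real.pi : ℝ) * I) = exp (Real.pi * I) := by
      push_cast
      rw [neg_mul, exp_neg, exp_pi_mul_I]
      norm_num
    rw [hends, sub_self, intervalIntegral.integral_const_mul] at h
    have h0 := (mul_eq_zero.1 h).resolve_left hρ'
    rw [integral_const_mul, ← integral_Ioc_eq_integral_Ioo,
      ← intervalIntegral.integral_of_le (by linarith [Real.pi_pos]), h0, mul_zero]
  rw [hA, hB, add_zero]

/-- **Cauchy–Green formula in skewed coordinates** (used in Lemma 4.3).  For `|c| < 1`,
an open disk `D`, `φ ∈ C_c^∞(D)` and `w ∈ D`,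
`(1/π) ∫_D (∂_z̄ φ - c ∂_z φ)/(w - z + c(w̄ - z̄)) dA(z) = φ(w)`. -/
theorem cauchy_green_skewed (c : ℂ) (hc : ‖c‖ < 1) (z₀ : ℂ) (r : ℝ) (hr : 0 < r)
    (φ : ℂ → ℂ) (hφ : ContDiff ℝ (⊤ : ℕ∞) φ) (hφc : HasCompactSupport φ)
    (hφs : tsupport φ ⊆ ball z₀ r) (w : ℂ) (hw : w ∈ ball z₀ r) :
    (1 / (Real.pi : ℂ)) *
        ∫ z in ball z₀ r,
          (dZbar φ z - c * dZ φ z) /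
            (w - z + c * ((starRingEnd ℂ) w - (starRingEnd ℂ) z)) = φ w := by
  have hzero : ∀ z, z ∉ ball z₀ r → (dZbar φ z - c * dZ φ z) /
      (w - z + c * ((starRingEnd ℂ) w - (starRingEnd ℂ) z)) = 0 := by
    intro z hz
    have h : fderiv ℝ φ z = 0 :=
      image_eq_zero_of_notMem_tsupport fun h => hz (hφs (tsupport_fderiv_subset ℝ h))
    simp [dZ, dZbar, h]
  rw [setIntegral_eq_integral_of_forall_compl_eq_zero hzero,
    ← integral_add_left_eq_self _ w, ← Complex.integral_comp_polarCoord_symm]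
  have hpolar : ∀ p ∈ polarCoord.target,
      p.1 • ((dZbar φ (w + Complex.polarCoord.symm p) - c * dZ φ (w + Complex.polarCoord.symm p)) /
        (w - (w + Complex.polarCoord.symm p) + c * ((starRingEnd ℂ) w -
          (starRingEnd ℂ) (w + Complex.polarCoord.symm p)))) =
      (-1 / 2 : ℂ) *
        ((exp (p.2 * I) - c * exp (-p.2 * I)) / (exp (p.2 * I) + c * exp (-p.2 * I)) *
          fderiv ℝ φ (w + p.1 * exp (p.2 * I)) (exp (p.2 * I)) +
        I * fderiv ℝ φ (w + p.1 * exp (p.2 * I)) (I * exp (p.2 * I))) := by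
    rintro ⟨ρ, θ⟩ ⟨hρ, -⟩
    have hρ' : (ρ : ℂ) ≠ 0 := by exact_mod_cast (ne_of_gt hρ)
    have hu : Complex.polarCoord.symm (ρ, θ) = ρ * exp (θ * I) := by
      rw [Complex.polarCoord_symm_apply, exp_mul_I]; simp
    have hconj : (starRingEnd ℂ) (exp (θ * I)) = exp (-θ * I) := by
      rw [← exp_conj]; simp
    have h0 := exp_mul_I_add_mul_exp_neg_ne_zero hc θ
    have hden : w - (w + ρ * exp (θ * I)) + c * ((starRingEnd ℂ) w -
        (starRingEnd ℂ) (w + ρ * exp (θ * I))) = -ρ * (exp (θ * I) + c * exp (-θ * I)) := by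
      rw [map_add, map_mul, hconj, conj_ofReal]; ring
    rw [hu, hden, dZbar_sub_mul_dZ_polar c φ _ θ, real_smul]
    dsimp only
    generalize exp (θ * I) + c * exp (-θ * I) = d at *
    field_simp
  rw [setIntegral_congr_fun polarCoord.open_target.measurableSet hpolar, integral_const_mul]
  have h := integral_polar_skewed hc hφ hφc w
  rw [show polarCoord.target = Ioi (0 : ℝ) ×ˢ Ioo (-Real.pi) Real.pi from rfl, h]
  have hpi : (Real.pi : ℂ) ≠ 0 := by exact_mod_cast Real.pi_ne_zero
  field_simp
end
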